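/- Let m₁ and m₂ be positive integers. There exist only finitely many pairs (q,n) ∈ ℕ² with q a prime power such that (q,n) ∉ B(m₁,m₂). -/

import Mathlib

open Polynomial

noncomputable section

/-- An element of a finite field is *primitive* if it generates the multiplicative group. -/
def IsPrimitiveElem {L : Type} [Field L] [Fintype L] (α : L) : Prop :=
  orderOf α = Fintype.card L - 1

/-- `β` is a *normal element* of `L` over `K`, where `n = [L : K]`:
the conjugates `β, β^q, …, β^(q^(n-1))` form a `K`-basis of `L`. -/
def IsNormalElem (K : Type) {L : Type} [Field K] [Fintype K] [Field L] [Algebra K L]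
    (n : ℕ) (β : L) : Prop :=
  LinearIndependent K (fun i : Fin n => β ^ Fintype.card K ^ (i : ℕ)) ∧
    Submodule.span K (Set.range fun i : Fin n => β ^ Fintype.card K ^ (i : ℕ)) = ⊤

/-- The set `Υ_Q(m₁, m₂)` of rational functions over the field `F` with `Q` elements. -/
def Upsilon (F : Type) [Field F] [Fintype F] (m₁ m₂ : ℕ) : Set (RatFunc F) :=
  {f | ∃ f₁ f₂ : F[X], f₂ ≠ 0 ∧
      f = algebraMap F[X] (RatFunc F) f₁ / algebraMap F[X] (RatFunc F) f₂ ∧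
      f₁.natDegree ≤ m₁ ∧ f₂.natDegree ≤ m₂ ∧ IsCoprime f₁ f₂ ∧
      ∃ (k : ℕ) (g : F[X]), 0 < k ∧ g.Monic ∧ Irreducible g ∧ g ≠ X ∧
        Nat.gcd k (Fintype.card F - 1) = 1 ∧
        g ^ k ∣ f₁ * f₂ ∧ ¬ g ^ (k + 1) ∣ f₁ * f₂}

/-- Evaluation of a rational function at a point of the same field (`0` if undefined). -/
def ratEval {F : Type} [Field F] (f : RatFunc F) (α : F) : F :=
  f.eval (RingHom.id F) α

/-- `α` is `s`-free. -/
def IsFree {F : Type} [Field F] (s : ℕ) (α : F) : Prop :=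
  α ≠ 0 ∧ ∀ d : ℕ, d ∣ s → d ≠ 1 → ¬ ∃ β : F, β ^ d = α

/-- The `F_q[x]`-module action `h ∘ β = ∑ hᵢ β^(qⁱ)` on `L`. -/
def polyAct {K L : Type} [Field K] [Fintype K] [Field L] [Algebra K L]
    (h : K[X]) (β : L) : L :=
  h.sum fun i a => algebraMap K L a * β ^ Fintype.card K ^ i

/-- `α` is `g`-free with respect to the `F_q[x]`-module structure of `L`. -/
def IsPolyFree (K : Type) {L : Type} [Field K] [Fintype K] [Field L] [Algebra K L]
    (g : K[X]) (α : L) : Prop :=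
  ∀ h : K[X], h.Monic → h ∣ g → (∃ lam : L, α = polyAct h lam) → h = 1

/-- `N_f(e₁, e₂, g)`: the number of `α ∈ L` such that `α` is `e₁`-free,
`f(α)` is `e₂`-free and `α` is `g`-free. -/
def NElems (K : Type) {L : Type} [Field K] [Fintype K] [Field L] [Fintype L] [Algebra K L]
    (f : RatFunc L) (e₁ e₂ : ℕ) (g : K[X]) : ℕ :=
  Nat.card {α : L | IsFree e₁ α ∧ IsFree e₂ (ratEval f α) ∧ IsPolyFree K g α}

/-- `W(ℓ)`: the number of squarefree divisors of `ℓ`. -/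
def Wnat (ℓ : ℕ) : ℕ := (ℓ.divisors.filter Squarefree).card

/-- `W_q(g)`: the number of monic squarefree divisors of `g` in `F_q[x]`. -/
def Wpoly {K : Type} [Field K] (g : K[X]) : ℕ :=
  Nat.card {h : K[X] // h.Monic ∧ Squarefree h ∧ h ∣ g}

/-- `Φ(g) = |(F_q[x]/(g))ˣ|`. -/
def PhiPoly {K : Type} [Field K] (g : K[X]) : ℕ :=
  Nat.card ((K[X] ⧸ Ideal.span ({g} : Set K[X]))ˣ)

/-- `(q, n) ∈ B(m₁, m₂)`: for every `f ∈ Υ_{qⁿ}(m₁, m₂)` there is a primitive element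
`α` of `F_{qⁿ}`, normal over `F_q`, with `f(α)` also primitive. -/
def memB (m₁ m₂ q n : ℕ) : Prop :=
  ∀ (K L : Type) [Field K] [Field L] [Fintype K] [Fintype L] [Algebra K L],
    Fintype.card K = q → Fintype.card L = q ^ n →
    ∀ f ∈ Upsilon L m₁ m₂,
      ∃ α : L, IsPrimitiveElem α ∧ IsNormalElem K n α ∧ IsPrimitiveElem (ratEval f α)

/-- `𝔑(q, n)`: the number of primitive elements of `F_{qⁿ}` that are normal over `F_q`. -/
def NNum (K L : Type) [Field K] [Fintype K] [Field L] [Fintype L] [Algebra K L] (n : ℕ) : ℕ :=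
  Nat.card {α : L | IsPrimitiveElem α ∧ IsNormalElem K n α}

end


section Stepanov

/-- All `x`-degrees of the coefficients of a bivariate polynomial are at most `N`. -/
def BddX {U : Type*} [Field U] (N : ℕ) (P : U[X][X]) : Prop := ∀ l, (P.coeff l).natDegree ≤ N

variable {U : Type*} [Field U]

lemma BddX.mono {N N' : ℕ} {P : U[X][X]} (h : BddX N P) (hN : N ≤ N') : BddX N' P :=
  fun l => (h l).trans hN

lemma BddX.mul {N N' : ℕ} {P P' : U[X][X]} (h : BddX N P) (h' : BddX N' P') :
    BddX (N + N') (P * P') := by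
  intro l
  rw [coeff_mul]
  refine natDegree_sum_le_of_forall_le _ _ fun x _ => ?_
  exact natDegree_mul_le.trans (add_le_add (h _) (h' _))

lemma BddX.const {N : ℕ} {p : U[X]} (h : p.natDegree ≤ N) : BddX N (C p) := by
  intro l
  rw [coeff_C]
  split_ifs <;> simp [h]

lemma BddX.add {N : ℕ} {P P' : U[X][X]} (h : BddX N P) (h' : BddX N P') :
    BddX N (P + P') := by
  intro l
  rw [coeff_add]
  exact natDegree_add_le_of_degree_le (h l) (h' l)

lemma BddX.sub {N : ℕ} {P P' : U[X][X]} (h : BddX N P) (h' : BddX N P') :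
    BddX N (P - P') := by
  intro l
  rw [coeff_sub]
  simpa using natDegree_sub_le_of_le (h l) (h' l)

lemma BddX.one : BddX 0 (1 : U[X][X]) := by
  rw [← C_1]; exact BddX.const (by simp)

lemma BddX.pow {N : ℕ} {P : U[X][X]} (h : BddX N P) (s : ℕ) : BddX (s * N) (P ^ s) := by
  induction s with
  | zero => simpa using BddX.one
  | succ s ih => rw [pow_succ, Nat.succ_mul]; exact ih.mul h

lemma BddX.sum {ι : Type*} (S : Finset ι) {N : ℕ} {P : ι → U[X][X]} (h : ∀ i ∈ S, BddX N (P i)) :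
    BddX N (∑ i ∈ S, P i) := by
  intro l
  rw [finsetSum_coeff]
  exact natDegree_sum_le_of_forall_le _ _ fun x hx => h x hx l

lemma BddX.XaddC : BddX 1 (X + C X : U[X][X]) := by
  refine BddX.add ?_ (BddX.const (by simp))
  intro l
  rw [coeff_X]
  split_ifs <;> simp

/-- `F(x+T)` as a bivariate polynomial. -/
noncomputable def tay2 (F : U[X]) : U[X][X] := F.eval₂ (C.comp C) (X + C X)

lemma BddX.taylor {D : ℕ} {F : U[X]} (h : F.natDegree ≤ D) : BddX D (tay2 F) := by
  unfold tay2
  rw [eval₂_eq_sum_range]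
  refine BddX.sum _ fun i hi => ?_
  have hi' : i ≤ D := by
    have := Finset.mem_range.mp hi
    omega
  have h1 : BddX 0 ((C.comp C : U →+* U[X][X]) (F.coeff i)) := by
    rw [RingHom.comp_apply]
    exact BddX.const (by simp)
  exact (h1.mul (BddX.XaddC.pow i)).mono (by omega)

lemma tay2_map (F : U[X]) (x : U) :
    (tay2 F).map (evalRingHom x) = F.comp (X + C x) := by
  unfold tay2
  rw [← coe_mapRingHom, hom_eval₂, comp]
  congr 1
  · ext a; simp
  · simp

/-- The truncated binomial expansion of `F(x)^M (F(x+T)/F(x))^n`. -/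
noncomputable def GG (F : U[X]) (M n : ℕ) : U[X][X] :=
  ∑ s ∈ Finset.range M, C (C (n.choose s : U) * F ^ (M - s)) * (tay2 F - C F) ^ s

lemma BddX.trunc {D : ℕ} {F : U[X]} (h : F.natDegree ≤ D) (M n : ℕ) : BddX (M * D) (GG F M n) := by
  unfold GG
  refine BddX.sum _ fun s hs => ?_
  have hs' := Finset.mem_range.mp hs
  have h1 : BddX ((M - s) * D) (Polynomial.C (Polynomial.C (n.choose s : U) * F ^ (M - s))) := by
    refine BddX.const ?_
    refine (natDegree_C_mul_le _ _).trans (natDegree_pow_le.trans (Nat.mul_le_mul_left _ h))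
  have h2 := ((BddX.taylor h).sub (BddX.const h)).pow s
  refine (h1.mul h2).mono ?_
  rw [← Nat.add_mul]
  apply Nat.mul_le_mul_right
  omega

lemma GG_map (F : U[X]) (M n : ℕ) (x : U) :
    X ^ M ∣ C (F.eval x) ^ M * (F.comp (X + C x)) ^ n -
      C (F.eval x) ^ n * (GG F M n).map (evalRingHom x) := by
  have hG : (GG F M n).map (evalRingHom x) = ∑ s ∈ Finset.range M,
      C (n.choose s : U) * C (F.eval x) ^ (M - s) * (F.comp (X + C x) - C (F.eval x)) ^ s := by
    unfold GG
    rw [Polynomial.map_sum]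
    refine Finset.sum_congr rfl fun s _ => ?_
    rw [Polynomial.map_mul, Polynomial.map_pow, Polynomial.map_sub, tay2_map, map_C, map_C]
    simp
  rw [hG]
  set b := F.comp (X + C x) - C (F.eval x) with hb
  have hXb : X ∣ b := by
    rw [X_dvd_iff, hb, coeff_zero_eq_eval_zero]
    simp
  have hF : F.comp (X + C x) = b + C (F.eval x) := by rw [hb]; ring
  rw [hF, add_pow]
  set a : U[X] := C (F.eval x)
  have key : ∀ s ∈ Finset.range (n + 1), X ^ M ∣ a ^ M * (b ^ s * a ^ (n - s) * (n.choose s : U[X]))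
      - (if s < M then a ^ n * (C (n.choose s : U) * a ^ (M - s) * b ^ s) else 0) := by
    intro s hs
    have hs' := Finset.mem_range.mp hs
    split_ifs with h
    · have : a ^ M * a ^ (n - s) = a ^ n * a ^ (M - s) := by
        rw [← pow_add, ← pow_add]; congr 1; omega
      have h2 : (C (n.choose s : U)) = (n.choose s : U[X]) := by simp
      rw [h2]
      have : a ^ M * (b ^ s * a ^ (n - s) * (n.choose s : U[X])) -
        a ^ n * ((n.choose s : U[X]) * a ^ (M - s) * b ^ s) = 0 := by
        linear_combination (b ^ s * (n.choose s : U[X])) * this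
      rw [this]; exact dvd_zero _
    · rw [sub_zero]
      refine Dvd.dvd.mul_left (Dvd.dvd.mul_right (Dvd.dvd.mul_right ?_ _) _) _
      exact (pow_dvd_pow _ (by omega)).trans (pow_dvd_pow_of_dvd hXb s)
  have := Finset.dvd_sum key
  rw [Finset.sum_sub_distrib, ← Finset.mul_sum] at this
  convert this using 2
  rw [Finset.mul_sum, ← Finset.sum_filter]
  symm
  apply Finset.sum_subset_zero_on_sdiff
  · intro s hs; simp at hs ⊢; exact hs.2
  · intro s hs
    simp at hs
    have : n.choose s = 0 := Nat.choose_eq_zero_of_lt (by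
      by_contra hh
      have := hs.2 (by omega)
      omega)
    simp [this]
  · intros; rfl

/-- sums of terms with pairwise distinct valuations do not vanish -/
lemma sum_ne_zero_of_val {ι : Type*} [Fintype ι] (ρ : U) (h : ι → U[X]) (w : ι → ℕ)
    (hw : ∀ i, h i ≠ 0 → (X - C ρ) ^ w i ∣ h i ∧ ¬ (X - C ρ) ^ (w i + 1) ∣ h i)
    (hinj : ∀ i j, h i ≠ 0 → h j ≠ 0 → w i = w j → i = j) (hne : ∃ i, h i ≠ 0) :
    ∑ i, h i ≠ 0 := by
  classical
  obtain ⟨i0, hi0⟩ := hne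
  obtain ⟨i, hi, hmin⟩ := Finset.exists_min_image (Finset.univ.filter fun i => h i ≠ 0) w
    ⟨i0, by simp [hi0]⟩
  simp only [Finset.mem_filter, Finset.mem_univ, true_and] at hi hmin
  intro h0
  apply (hw i hi).2
  rw [← Finset.add_sum_erase _ _ (Finset.mem_univ i)] at h0
  rw [eq_neg_of_add_eq_zero_left h0]
  rw [dvd_neg]
  refine Finset.dvd_sum fun j hj => ?_
  by_cases hj0 : h j = 0
  · rw [hj0]; exact dvd_zero _
  · refine (pow_dvd_pow _ ?_).trans (hw j hj0).1
    have := hmin j hj0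
    have hne : w i ≠ w j := fun e => (Finset.ne_of_mem_erase hj) (hinj _ _ hj0 hi e.symm)
    omega

lemma frob_mod (p s Q i M : ℕ) [Fact p.Prime] [CharP U p] (hQ : Q = p ^ s) (x ρ : U)
    (hx : x ^ Q = x) (hM : M ≤ Q) :
    (X : U[X]) ^ M ∣ (X + C x - C ρ) ^ (i * Q) - C ((x - ρ ^ Q) ^ i) := by
  have h1 : (X + C x - C ρ) ^ Q = (X : U[X]) ^ Q + C (x - ρ ^ Q) := by
    rw [hQ, sub_pow_char_pow, add_pow_char_pow, ← hQ, ← C_pow, ← C_pow, hx, C_sub]; ring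
  rw [mul_comm, pow_mul, h1, C_pow]
  refine dvd_trans (pow_dvd_pow _ hM) ?_
  refine dvd_trans ?_ (sub_dvd_pow_sub_pow _ _ i)
  simp

theorem stepanov (p s Q d E D I M K k : ℕ) [Fact p.Prime] [CharP U p] (hQ : Q = p ^ s)
    (hdE : Q = d * E + 1) (F F0 : U[X]) (ρ c : U) (Xs : Finset U)
    (hX : ∀ x ∈ Xs, x ^ Q = x ∧ F.eval x ^ E = c) (hc : c ≠ 0)
    (hKI : K + I ≤ E) (hMQ : M ≤ Q) (hdim : M * (K + M * D + I) < I * d * K)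
    (hF : F = (X - C ρ) ^ k * F0) (hF0 : F0.eval ρ ≠ 0) (hk : k.Coprime d)
    (hFD : F.natDegree ≤ D) :
    Xs.card * M ≤ K + d * E * D + I * Q := by
  classical
  have hI : 0 < I := by by_contra h; simp [show I = 0 by omega] at hdim
  have hK : 0 < K := by by_contra h; simp [show K = 0 by omega] at hdim
  have hE : 0 < E := by omega
  set N := K + M * D + I with hN
  let B : Fin I × Fin d × Fin K → U[X][X] := fun u =>
    (X + C X) ^ (u.2.2 : ℕ) * C ((X - C (ρ ^ Q)) ^ (u.1 : ℕ) * C (c ^ (u.2.1 : ℕ))) *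
      GG F M ((u.2.1 : ℕ) * E)
  have hB : ∀ u, BddX (N - 1) (B u) := by
    intro u
    have h1 : BddX (K - 1) ((X + C X : U[X][X]) ^ (u.2.2 : ℕ)) :=
      (BddX.XaddC.pow _).mono (by have := u.2.2.2; omega)
    have h2 : BddX (I - 1) (C ((X - C (ρ ^ Q)) ^ (u.1 : ℕ) * C (c ^ (u.2.1 : ℕ))) : U[X][X]) := by
      refine BddX.const ?_
      refine (natDegree_mul_C_le _ _).trans ?_
      rw [natDegree_pow, natDegree_X_sub_C]
      have := u.1.2; omega
    exact ((h1.mul h2).mul (BddX.trunc hFD M _)).mono (by omega)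
  let A : Matrix (Fin M × Fin N) (Fin I × Fin d × Fin K) U :=
    Matrix.of fun lr u => ((B u).coeff lr.1).coeff lr.2
  have hker : LinearMap.ker A.mulVecLin ≠ ⊥ := by
    apply LinearMap.ker_ne_bot_of_finrank_lt
    simp only [Module.finrank_fintype_fun_eq_card, Fintype.card_prod, Fintype.card_fin]
    rw [← mul_assoc]; exact hdim
  obtain ⟨a, ha, ha0⟩ := Submodule.exists_mem_ne_zero_of_ne_bot hker
  have ha' : ∀ l : ℕ, l < M → (∑ u, C (C (a u)) * B u).coeff l = 0 := by
    intro l hl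
    ext r
    rw [finsetSum_coeff, finsetSum_coeff, coeff_zero]
    by_cases hr : r < N
    · have := congrFun (LinearMap.mem_ker.mp ha) (⟨l, hl⟩, ⟨r, hr⟩)
      simp only [Matrix.mulVecLin_apply, Matrix.mulVec, dotProduct, A, Matrix.of_apply,
        Pi.zero_apply] at this
      rw [← this]
      refine Finset.sum_congr rfl fun u _ => ?_
      rw [coeff_C_mul, coeff_C_mul, mul_comm]
    · refine Finset.sum_eq_zero fun u _ => ?_
      rw [coeff_C_mul, coeff_C_mul, coeff_eq_zero_of_natDegree_lt, mul_zero]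
      have := hB u l
      omega
  let kp : Fin I × Fin d → U[X] := fun v => ∑ t : Fin K, C (a (v.1, v.2, t)) * X ^ (t : ℕ)
  let H : Fin I × Fin d → U[X] := fun v =>
    kp v * (X - C ρ) ^ ((v.1 : ℕ) * Q) * F ^ ((v.2 : ℕ) * E)
  set R : U[X] := ∑ v, H v with hR
  have hF00 : F0 ≠ 0 := by rintro rfl; simp at hF0
  have hFne : F ≠ 0 := by
    rw [hF]; exact mul_ne_zero (pow_ne_zero _ (X_sub_C_ne_zero ρ)) hF00
  have hkp_deg : ∀ v, (kp v).natDegree ≤ K - 1 := by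
    intro v
    refine natDegree_sum_le_of_forall_le _ _ fun t _ => ?_
    refine (natDegree_C_mul_X_pow_le _ _).trans ?_
    have := t.2; omega
  have hRne : R ≠ 0 := by
    refine sum_ne_zero_of_val ρ H (fun v => (H v).rootMultiplicity ρ) ?_ ?_ ?_
    · intro v hv
      refine ⟨pow_rootMultiplicity_dvd _ _, fun h => ?_⟩
      have := (le_rootMultiplicity_iff hv).mpr h
      omega
    · intro v v' hv hv' hvv
      have key : ∀ v, H v ≠ 0 → ∃ r < K, (H v).rootMultiplicity ρ =
          r + (v.1 : ℕ) * Q + (v.2 : ℕ) * E * k := by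
        intro v hv
        have hkv : kp v ≠ 0 := by
          intro h; apply hv; simp [H, h]
        refine ⟨(kp v).rootMultiplicity ρ, ?_, ?_⟩
        · have h1 : (kp v).rootMultiplicity ρ ≤ (kp v).natDegree := by
            rw [← count_roots]
            exact (Multiset.count_le_card _ _).trans (card_roots' _)
          have := hkp_deg v
          omega
        · have hFr : F.rootMultiplicity ρ = k := by
            rw [hF, rootMultiplicity_mul (by rw [← hF]; exact hFne), rootMultiplicity_X_sub_C_pow,
              rootMultiplicity_eq_zero (by simpa [IsRoot] using hF0), add_zero]
          have hpow : ∀ n, (F ^ n).rootMultiplicity ρ = n * k := by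
            intro n
            rw [← count_roots, roots_pow, Multiset.count_nsmul, count_roots, hFr]
          simp only [H]
          rw [rootMultiplicity_mul hv, rootMultiplicity_mul (left_ne_zero_of_mul hv),
            rootMultiplicity_X_sub_C_pow, hpow]
      obtain ⟨r, hr, hr'⟩ := key v hv
      obtain ⟨r', hr1, hr1'⟩ := key v' hv'
      change rootMultiplicity ρ (H v) = rootMultiplicity ρ (H v') at hvv
      rw [hr', hr1'] at hvv
      have e1 : ∀ (r i j : ℕ), r + i * Q + j * E * k = (r + i) + E * (i * d + j * k) := by
        intro r i j; rw [hdE]; ring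
      rw [e1, e1] at hvv
      have hlt : r + v.1 < E := by have := v.1.2; omega
      have hlt' : r' + v'.1 < E := by have := v'.1.2; omega
      have hq : (v.1 : ℕ) * d + v.2 * k = v'.1 * d + v'.2 * k := by
        have := congrArg (· / E) hvv
        simpa [Nat.add_mul_div_left _ _ hE, Nat.div_eq_of_lt hlt, Nat.div_eq_of_lt hlt'] using this
      have hm : (v.2 : ℕ) * k ≡ v'.2 * k [MOD d] := by
        have := congrArg (· % d) hq
        simpa [Nat.ModEq, Nat.add_mod, Nat.mul_mod] using this
      have hm2 := Nat.ModEq.cancel_right_of_coprime (by rw [Nat.gcd_comm]; exact hk) hm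
      have hj : (v.2 : ℕ) = v'.2 := Nat.ModEq.eq_of_lt_of_lt hm2 v.2.2 v'.2.2
      have hd : 0 < d := lt_of_le_of_lt (Nat.zero_le _) v.2.2
      rw [hj] at hq
      have hi : (v.1 : ℕ) = v'.1 := by
        exact Nat.eq_of_mul_eq_mul_right hd (by omega)
      exact Prod.ext (Fin.ext hi) (Fin.ext hj)
    · obtain ⟨u, hu⟩ := Function.ne_iff.mp ha0
      refine ⟨(u.1, u.2.1), ?_⟩
      refine mul_ne_zero (mul_ne_zero ?_ (pow_ne_zero _ (X_sub_C_ne_zero ρ))) (pow_ne_zero _ hFne)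
      intro h0
      have := congrArg (fun q => coeff q (u.2.2 : ℕ)) h0
      simp only [kp, finsetSum_coeff, coeff_C_mul, coeff_X_pow, coeff_zero, mul_ite, mul_one,
        mul_zero] at this
      rw [Finset.sum_eq_single u.2.2] at this
      · simp at this; exact hu this
      · intro b _ hb
        rw [if_neg]
        intro h; exact hb (Fin.ext h.symm)
      · simp
  have hRdeg : R.natDegree ≤ K + d * E * D + I * Q := by
    refine natDegree_sum_le_of_forall_le _ _ fun v _ => ?_
    refine natDegree_mul_le.trans ?_
    have h1 : (kp v * (X - C ρ) ^ ((v.1 : ℕ) * Q)).natDegree ≤ K + I * Q := by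
      refine natDegree_mul_le.trans (add_le_add ((hkp_deg v).trans (by omega)) ?_)
      rw [natDegree_pow, natDegree_X_sub_C, mul_one]
      exact Nat.mul_le_mul_right _ v.1.2.le
    have h2 : (F ^ ((v.2 : ℕ) * E)).natDegree ≤ d * E * D := by
      refine natDegree_pow_le.trans (Nat.mul_le_mul (Nat.mul_le_mul_right _ v.2.2.le) hFD)
    omega
  have hdvd : ∀ x ∈ Xs, (X - C x) ^ M ∣ R := by
    intro x hx
    obtain ⟨hx1, hx2⟩ := hX x hx
    have hFx : F.eval x ≠ 0 := by
      intro h; rw [h, zero_pow hE.ne'] at hx2; exact hc hx2.symm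
    have hmap : (X : U[X]) ^ M ∣ ∑ u, C (a u) * (B u).map (evalRingHom x) := by
      rw [X_pow_dvd_iff]
      intro l hl
      have := congrArg (eval x) (ha' l hl)
      rw [finsetSum_coeff, eval_finsetSum] at this
      rw [finsetSum_coeff]
      simpa using this
    have hsum : R = ∑ u : Fin I × Fin d × Fin K,
        C (a u) * (X ^ (u.2.2 : ℕ) * (X - C ρ) ^ ((u.1 : ℕ) * Q) * F ^ ((u.2.1 : ℕ) * E)) := by
      rw [hR, Fintype.sum_prod_type, Fintype.sum_prod_type]
      refine Finset.sum_congr rfl fun i _ => ?_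
      rw [Fintype.sum_prod_type]
      refine Finset.sum_congr rfl fun j _ => ?_
      simp only [H, kp, Finset.sum_mul]
      refine Finset.sum_congr rfl fun t _ => by ring
    have hdiff : (X : U[X]) ^ M ∣ C (F.eval x) ^ M * R.comp (X + C x) -
        ∑ u, C (a u) * (B u).map (evalRingHom x) := by
      rw [hsum, Polynomial.sum_comp, Finset.mul_sum, ← Finset.sum_sub_distrib]
      refine Finset.dvd_sum fun u _ => ?_
      have e1 := GG_map F M ((u.2.1 : ℕ) * E) x
      have e2 := frob_mod p s Q u.1 M hQ x ρ hx1 hMQ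
      have e3 : (C (F.eval x) : U[X]) ^ ((u.2.1 : ℕ) * E) = C (c ^ (u.2.1 : ℕ)) := by
        rw [← C_pow, mul_comm, pow_mul, hx2]
      rw [e3] at e1
      have e4 : (B u).map (evalRingHom x) = (X + C x) ^ (u.2.2 : ℕ) *
          (C ((x - ρ ^ Q) ^ (u.1 : ℕ)) * C (c ^ (u.2.1 : ℕ))) *
          (GG F M ((u.2.1 : ℕ) * E)).map (evalRingHom x) := by
        simp [B]
      rw [e4]
      simp only [mul_comp, pow_comp, sub_comp, C_comp, X_comp]
      obtain ⟨w1, hw1⟩ := e1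
      obtain ⟨w2, hw2⟩ := e2
      rw [show X + C x - C ρ = X + C x - C ρ from rfl] at hw2
      refine ⟨C (a u) * (X + C x) ^ (u.2.2 : ℕ) * (w1 * C ((x - ρ ^ Q) ^ (u.1 : ℕ)) +
        w2 * (C (F.eval x) ^ M * F.comp (X + C x) ^ ((u.2.1 : ℕ) * E))), ?_⟩
      linear_combination (C (a u) * (X + C x) ^ (u.2.2 : ℕ)) *
        (C ((x - ρ ^ Q) ^ (u.1 : ℕ)) * hw1 +
          (C (F.eval x) ^ M * F.comp (X + C x) ^ ((u.2.1 : ℕ) * E)) * hw2)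
    have h3 : (X : U[X]) ^ M ∣ C (F.eval x) ^ M * R.comp (X + C x) := by
      have := dvd_add hdiff hmap
      simpa using this
    have h4 : (X : U[X]) ^ M ∣ R.comp (X + C x) := by
      have hu : IsUnit (C (F.eval x) ^ M : U[X]) := (isUnit_C.mpr hFx.isUnit).pow M
      exact (hu.dvd_mul_left).mp h3
    obtain ⟨w, hw⟩ := h4
    refine ⟨w.comp (X - C x), ?_⟩
    have := congrArg (fun q => q.comp (X - C x)) hw
    simpa [comp_assoc] using this
  have hprod : ∏ x ∈ Xs, (X - C x) ^ M ∣ R := by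
    refine Finset.prod_dvd_of_coprime ?_ hdvd
    intro x _ y _ hxy
    exact (isCoprime_X_sub_C_of_isUnit_sub (sub_ne_zero.mpr hxy).isUnit).pow
  have := natDegree_le_of_dvd hprod hRne
  rw [natDegree_prod_of_monic _ _ (fun x _ => (monic_X_sub_C x).pow M)] at this
  simp only [natDegree_pow, natDegree_X_sub_C, mul_one, Finset.sum_const, smul_eq_mul] at this
  omega

end Stepanov


section Pure

variable {L : Type} [Field L] [Fintype L]

/-- The bound from Stepanov's method for one fibre of the `E`-th power of `F`. -/
lemma fibre_bound [DecidableEq L] (d E D μ k : ℕ) (hdE : Fintype.card L = d * E + 1) (F : L[X])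
    (F0 : (AlgebraicClosure L)[X]) (ρ : AlgebraicClosure L)
    (hF : F.map (algebraMap L (AlgebraicClosure L)) = (X - C ρ) ^ k * F0)
    (hF0 : F0.eval ρ ≠ 0) (hk : k.Coprime d) (hFD : F.natDegree ≤ D) (hμ : 1 ≤ μ)
    (hE : (4 + d * D) * μ ^ 2 + 1 ≤ E) (hd : 0 < d) (c : L) (hc : c ≠ 0) :
    ((Finset.univ.filter fun y : L => F.eval y ^ E = c).card : ℝ) ≤
      (Fintype.card L : ℝ) / d + (Fintype.card L : ℝ) * (D + 2) / (d * μ) := by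
  obtain ⟨p, hp⟩ := CharP.exists L
  obtain ⟨n, hprime, hcard⟩ := FiniteField.card L p
  have : Fact p.Prime := ⟨hprime⟩
  have : CharP (AlgebraicClosure L) p := charP_of_injective_algebraMap
    (algebraMap L (AlgebraicClosure L)).injective p
  set Q := Fintype.card L with hQ
  set ι := algebraMap L (AlgebraicClosure L) with hι
  have hmu2 : (μ + 1) ^ 2 ≤ 4 * μ ^ 2 := by nlinarith
  have hsmall : μ + 1 ≤ E := by nlinarith [Nat.zero_le (d * D * μ ^ 2)]
  have hst := stepanov p n Q d E D (μ + 1) (d * μ) (E - (μ + 1)) k hcard hdE (F.map ι) F0 ρ (ι c)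
    ((Finset.univ.filter fun y : L => F.eval y ^ E = c).map ⟨ι, ι.injective⟩)
    (by
      intro x hx
      simp only [Finset.mem_map, Finset.mem_filter, Finset.mem_univ, true_and,
        Function.Embedding.coeFn_mk] at hx
      obtain ⟨y, hy, rfl⟩ := hx
      refine ⟨?_, ?_⟩
      · rw [← map_pow, FiniteField.pow_card]
      · rw [eval_map, eval₂_at_apply, ← map_pow, hy])
    (by simpa using hc) (by omega) (by nlinarith)
    (by
      obtain ⟨K, hK⟩ : ∃ K, E = K + (μ + 1) := ⟨E - (μ + 1), by omega⟩
      have : E - (μ + 1) = K := by omega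
      rw [this]
      have h1 : (4 * μ ^ 2 + d * D * μ ^ 2) + 1 ≤ K + (μ + 1) := by rw [← hK]; nlinarith
      have h2 : μ * (K + d * μ * D + (μ + 1)) < (μ + 1) * K := by nlinarith
      calc d * μ * (K + d * μ * D + (μ + 1)) = d * (μ * (K + d * μ * D + (μ + 1))) := by ring
        _ < d * ((μ + 1) * K) := Nat.mul_lt_mul_of_pos_left h2 hd
        _ = _ := by ring) hF hF0 hk (by simpa using hFD)
  rw [Finset.card_map] at hst
  set N := (Finset.univ.filter fun y : L => F.eval y ^ E = c).card with hN
  have hst' : N * (d * μ) ≤ μ * Q + Q * (D + 2) := by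
    have : E - (μ + 1) ≤ Q := by
      have : E ≤ d * E := Nat.le_mul_of_pos_left _ hd
      omega
    have h2 : d * E * D ≤ Q * D := Nat.mul_le_mul_right _ (by omega)
    nlinarith
  have hst2 : (N : ℝ) * (d * μ) ≤ μ * Q + Q * (D + 2) := by exact_mod_cast hst'
  have hd' : (0 : ℝ) < d := by exact_mod_cast hd
  have hμ' : (0 : ℝ) < μ := by exact_mod_cast hμ
  have : (Q : ℝ) / d + (Q : ℝ) * (D + 2) / (d * μ) = (μ * Q + Q * (D + 2)) / (d * μ) := by
    field_simp
  rw [this, le_div_iff₀ (by positivity)]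
  exact hst2

/-- A faithful multiplicative character. -/
def Faithful (θ : MulChar L ℂ) : Prop := ∀ x : L, θ x = 1 → x = 1

lemma exists_faithful : ∃ θ : MulChar L ℂ, Faithful θ := by
  classical
  have hcard : Fintype.card L - 1 ≠ 0 := by
    have := Fintype.one_lt_card (α := L); omega
  obtain ⟨θ, hθ⟩ := MulChar.exists_mulChar_orderOf L (dvd_refl (Fintype.card L - 1))
    (Complex.isPrimitiveRoot_exp _ hcard)
  refine ⟨θ, fun x hx => ?_⟩
  have hx0 : x ≠ 0 := by
    rintro rfl
    rw [MulChar.map_zero] at hx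
    exact zero_ne_one hx
  obtain ⟨g, hg⟩ := IsCyclic.exists_generator (α := Lˣ)
  obtain ⟨n, hn⟩ := (Submonoid.mem_powers_iff _ _).mp
    (mem_powers_iff_mem_zpowers.mpr (hg (Units.mk0 x hx0)))
  have h1 : θ ^ n = 1 := by
    ext u
    obtain ⟨m, hm⟩ := (Submonoid.mem_powers_iff _ _).mp (mem_powers_iff_mem_zpowers.mpr (hg u))
    rw [← hm, MulChar.pow_apply_coe, MulChar.one_apply_coe, Units.val_pow_eq_pow_val, map_pow,
      ← pow_mul, mul_comm, pow_mul]
    have : θ x = θ (g : L) ^ n := by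
      rw [← map_pow, ← Units.val_pow_eq_pow_val, hn, Units.val_mk0]
    rw [← this, hx, one_pow]
  have h2 := orderOf_dvd_of_pow_eq_one h1
  rw [hθ] at h2
  obtain ⟨m, hm⟩ := h2
  have : (Units.mk0 x hx0) = 1 := by
    rw [← hn, hm, pow_mul, ← Fintype.card_units, pow_card_eq_one, one_pow]
  simpa using congrArg Units.val this

lemma norm_mulChar_le (χ : MulChar L ℂ) (x : L) : ‖χ x‖ ≤ 1 := by
  by_cases hx : x = 0
  · rw [hx, MulChar.map_zero, norm_zero]; exact zero_le_one
  · have h1 : χ x ^ (Fintype.card L - 1) = 1 := by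
      rw [← map_pow, FiniteField.pow_card_sub_one_eq_one x hx, map_one]
    have : Fintype.card L - 1 ≠ 0 := by
      have := Fintype.one_lt_card (α := L); omega
    exact (Complex.norm_eq_one_of_pow_eq_one h1 this).le

theorem pure_bound (θ : MulChar L ℂ) (hθ : Faithful θ)
    (d E D μ k j : ℕ) (hdE : Fintype.card L = d * E + 1) (F : L[X])
    (F0 : (AlgebraicClosure L)[X]) (ρ : AlgebraicClosure L)
    (hF : F.map (algebraMap L (AlgebraicClosure L)) = (X - C ρ) ^ k * F0)
    (hF0 : F0.eval ρ ≠ 0) (hk : k.Coprime d) (hFD : F.natDegree ≤ D) (hμ : 1 ≤ μ)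
    (hE : (4 + d * D) * μ ^ 2 + 1 ≤ E) (hj : 0 < j) (hjd : j < d) :
    ‖∑ y : L, (θ ^ (E * j)) (F.eval y)‖ ≤ (Fintype.card L : ℝ) * (D + 2) / μ + D := by
  classical
  have hd : 0 < d := by omega
  have hE0 : 0 < E := by omega
  set Q := Fintype.card L with hQ
  have hFne : F ≠ 0 := by
    rintro rfl
    rw [Polynomial.map_zero] at hF
    have : F0 = 0 := by
      rcases mul_eq_zero.mp hF.symm with h | h
      · exact absurd h (pow_ne_zero _ (X_sub_C_ne_zero ρ))
      · exact h
    rw [this] at hF0; simp at hF0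
  set Cs : Finset L := Finset.univ.filter fun c : L => c ^ d = 1 with hCs
  have hCcard : Cs.card ≤ d := by
    have : Cs ⊆ (nthRoots d (1 : L)).toFinset := by
      intro c hc
      rw [Multiset.mem_toFinset, mem_nthRoots hd]
      simpa [Cs] using hc
    exact (Finset.card_le_card this).trans ((Multiset.toFinset_card_le _).trans (card_nthRoots _ _))
  let Xc : L → ℕ := fun c => (Finset.univ.filter fun y : L => F.eval y ^ E = c).card
  set B : ℝ := (Q : ℝ) / d + (Q : ℝ) * (D + 2) / (d * μ) with hB
  have hXB : ∀ c ∈ Cs, (Xc c : ℝ) ≤ B := by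
    intro c hc
    have hc0 : c ≠ 0 := by
      rintro rfl; simp [Cs, hd.ne'] at hc
    exact fibre_bound d E D μ k hdE F F0 ρ hF hF0 hk hFD hμ hE hd c hc0
  have hmem : ∀ y : L, F.eval y ≠ 0 → F.eval y ^ E ∈ Cs := by
    intro y hy
    simp only [Cs, Finset.mem_filter, Finset.mem_univ, true_and]
    rw [← pow_mul, mul_comm]
    have := FiniteField.pow_card_sub_one_eq_one _ hy
    rwa [← hQ, hdE, Nat.add_sub_cancel] at this
  -- number of nonzeros
  have hnz : Q ≤ ∑ c ∈ Cs, Xc c + D := by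
    have h1 : (Finset.univ.filter fun y : L => F.eval y ≠ 0).card = ∑ c ∈ Cs, Xc c := by
      rw [Finset.card_eq_sum_card_fiberwise (f := fun y => F.eval y ^ E) (t := Cs)]
      · refine Finset.sum_congr rfl fun c hc => ?_
        congr 1
        ext y
        simp only [Finset.mem_filter, Finset.mem_univ, true_and]
        refine ⟨fun h => h.2, fun h => ⟨fun h0 => ?_, h⟩⟩
        rw [h0, zero_pow hE0.ne'] at h
        subst h
        simp [Cs, hd.ne'] at hc
      · intro y hy
        exact hmem y (by simpa using hy)
    have h2 : (Finset.univ.filter fun y : L => F.eval y = 0).card ≤ D := by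
      have : (Finset.univ.filter fun y : L => F.eval y = 0) ⊆ F.roots.toFinset := by
        intro y hy
        rw [Multiset.mem_toFinset, mem_roots hFne]
        simpa using hy
      exact (Finset.card_le_card this).trans ((Multiset.toFinset_card_le _).trans
        ((card_roots' _).trans hFD))
    have h3 := Finset.card_filter_add_card_filter_not (s := (Finset.univ : Finset L))
      (fun y => F.eval y = 0)
    rw [Finset.card_univ] at h3
    simp only [ne_eq] at h1
    omega
  have hsum : ∑ y : L, (θ ^ (E * j)) (F.eval y) = ∑ c ∈ Cs, (Xc c : ℂ) * θ c ^ j := by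
    rw [← Finset.sum_subset (Finset.subset_univ (Finset.univ.filter fun y : L => F.eval y ≠ 0))]
    · rw [← Finset.sum_fiberwise_of_maps_to (g := fun y => F.eval y ^ E) (t := Cs)]
      · refine Finset.sum_congr rfl fun c hc => ?_
        rw [Finset.sum_congr rfl (g := fun _ => θ c ^ j)]
        · rw [Finset.sum_const, nsmul_eq_mul]
          congr 2
          simp only [Xc]
          congr 1
          ext y
          simp only [Finset.mem_filter, Finset.mem_univ, true_and]
          refine ⟨fun h => h.2, fun h => ⟨fun h0 => ?_, h⟩⟩
          rw [h0, zero_pow hE0.ne'] at h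
          subst h
          simp [Cs, hd.ne'] at hc
        · intro y hy
          simp only [Finset.mem_filter, Finset.mem_univ, true_and] at hy
          rw [MulChar.pow_apply' _ (by positivity), pow_mul, ← map_pow, hy.2]
      · intro y hy
        exact hmem y (by simpa using hy)
    · intro y _ hy
      simp only [Finset.mem_filter, Finset.mem_univ, true_and, not_not] at hy
      rw [hy, MulChar.map_zero]
  have hzero : ∑ c ∈ Cs, θ c ^ j = 0 := by
    obtain ⟨g, hg⟩ := IsCyclic.exists_generator (α := Lˣ)
    have hog : orderOf g = d * E := by
      rw [orderOf_eq_card_of_forall_mem_zpowers hg, Nat.card_eq_fintype_card, Fintype.card_units,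
        ← hQ, hdE, Nat.add_sub_cancel]
    set c0 : L := ((g ^ E : Lˣ) : L) with hc0
    have hc0d : c0 ^ d = 1 := by
      rw [hc0, ← Units.val_pow_eq_pow_val, ← pow_mul, mul_comm, ← hog, pow_orderOf_eq_one,
        Units.val_one]
    have hc0j : θ c0 ^ j ≠ 1 := by
      intro h
      rw [← map_pow] at h
      have h1 := hθ _ h
      rw [hc0, ← Units.val_pow_eq_pow_val, ← pow_mul, Units.val_eq_one] at h1
      have := Nat.le_of_dvd (by positivity) (orderOf_dvd_of_pow_eq_one h1)
      rw [hog] at this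
      nlinarith
    have hc00 : c0 ≠ 0 := Units.ne_zero _
    have hinv : ∑ c ∈ Cs, θ c ^ j = θ c0 ^ j * ∑ c ∈ Cs, θ c ^ j := by
      rw [Finset.mul_sum]
      symm
      refine Finset.sum_bij' (fun c _ => c0 * c) (fun c _ => c0⁻¹ * c) ?_ ?_ ?_ ?_ ?_
      · intro c hc
        simp only [Cs, Finset.mem_filter, Finset.mem_univ, true_and] at hc ⊢
        rw [mul_pow, hc, hc0d, one_mul]
      · intro c hc
        simp only [Cs, Finset.mem_filter, Finset.mem_univ, true_and] at hc ⊢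
        rw [mul_pow, hc, inv_pow, hc0d, inv_one, one_mul]
      · intro c _; field_simp
      · intro c _; field_simp
      · intro c _; rw [map_mul, mul_pow]
    have : (1 - θ c0 ^ j) * ∑ c ∈ Cs, θ c ^ j = 0 := by
      rw [sub_mul, one_mul, ← hinv, sub_self]
    rcases mul_eq_zero.mp this with h | h
    · exact absurd (sub_eq_zero.mp h).symm hc0j
    · exact h
  have hsum2 : ∑ y : L, (θ ^ (E * j)) (F.eval y) = ∑ c ∈ Cs, ((Xc c : ℂ) - (B : ℂ)) * θ c ^ j := by
    rw [hsum]
    simp only [sub_mul, Finset.sum_sub_distrib, ← Finset.mul_sum, hzero, mul_zero, sub_zero]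
  rw [hsum2]
  have hle : ‖∑ c ∈ Cs, ((Xc c : ℂ) - (B : ℂ)) * θ c ^ j‖ ≤ ∑ c ∈ Cs, (B - Xc c) := by
    refine (norm_sum_le _ _).trans (Finset.sum_le_sum fun c hc => ?_)
    rw [norm_mul, norm_pow]
    have h1 : ‖(Xc c : ℂ) - (B : ℂ)‖ = B - Xc c := by
      rw [← Complex.ofReal_natCast, ← Complex.ofReal_sub, Complex.norm_real, Real.norm_eq_abs,
        abs_sub_comm, abs_of_nonneg (by have := hXB c hc; linarith)]
    rw [h1]
    have h2 : ‖θ c‖ ^ j ≤ 1 := pow_le_one₀ (norm_nonneg _) (norm_mulChar_le θ c)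
    have := hXB c hc
    nlinarith
  refine hle.trans ?_
  rw [Finset.sum_sub_distrib, Finset.sum_const, nsmul_eq_mul]
  have hnz' : (Q : ℝ) ≤ ∑ c ∈ Cs, (Xc c : ℝ) + D := by exact_mod_cast hnz
  have hBpos : 0 ≤ B := by positivity
  have hC : (Cs.card : ℝ) * B ≤ d * B := by
    apply mul_le_mul_of_nonneg_right _ hBpos
    exact_mod_cast hCcard
  have hd' : (0 : ℝ) < d := by exact_mod_cast hd
  have hμ' : (0 : ℝ) < μ := by exact_mod_cast hμ
  have hdB : (d : ℝ) * B = Q + (Q : ℝ) * (D + 2) / μ := by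
    rw [hB]; field_simp
  linarith

end Pure


section Mixed

variable {L : Type} [Field L] [Fintype L]

open ComplexConjugate in
lemma coset_cauchy (Φ : L → ℂ) (V : AddSubgroup L) [Fintype V] :
    ‖∑ x : V, Φ x‖ ^ 2 ≤ ‖∑ h : V, ∑ c : L, Φ (c + h) * conj (Φ c)‖ := by
  classical
  have hVpos : (0 : ℝ) < Fintype.card V := by
    exact_mod_cast Fintype.card_pos
  have h1 : ∀ c : V, ∑ x : V, Φ (x + c) = ∑ x : V, Φ x := by
    intro c
    exact Fintype.sum_equiv (Equiv.addRight c) _ _ (fun x => by simp)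
  have h2 : (Fintype.card V : ℝ) * ‖∑ x : V, Φ x‖ ^ 2 ≤ ∑ c : L, ‖∑ x : V, Φ (x + c)‖ ^ 2 := by
    have e1 : (Fintype.card V : ℝ) * ‖∑ x : V, Φ x‖ ^ 2 = ∑ c : V, ‖∑ x : V, Φ (x + c)‖ ^ 2 := by
      simp only [h1, Finset.sum_const, Finset.card_univ, nsmul_eq_mul]
    have e2 : ∑ c : V, ‖∑ x : V, Φ (x + c)‖ ^ 2 =
        ∑ c ∈ Finset.univ.map ⟨((↑) : V → L), Subtype.val_injective⟩, ‖∑ x : V, Φ (x + c)‖ ^ 2 := by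
      rw [Finset.sum_map]; rfl
    rw [e1, e2]
    exact Finset.sum_le_sum_of_subset_of_nonneg (Finset.subset_univ _) (fun _ _ _ => by positivity)
  have h3 : ((∑ c : L, ‖∑ x : V, Φ (x + c)‖ ^ 2 : ℝ) : ℂ) =
      (Fintype.card V : ℂ) * ∑ h : V, ∑ c : L, Φ (c + h) * conj (Φ c) := by
    push_cast
    have e : ∀ c : L, ((‖∑ x : V, Φ (x + c)‖ : ℂ)) ^ 2 =
        ∑ x' : V, ∑ x : V, Φ (x + c) * conj (Φ (x' + c)) := by
      intro c
      rw [← Complex.mul_conj', map_sum, Finset.mul_sum]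
      refine Finset.sum_congr rfl fun x' _ => ?_
      rw [Finset.sum_mul]
    rw [Finset.sum_congr rfl (fun c _ => e c), Finset.sum_comm]
    have e3 : ∀ x' : V, ∑ c : L, ∑ x : V, Φ (x + c) * conj (Φ (x' + c)) =
        ∑ h : V, ∑ c : L, Φ (c + h) * conj (Φ c) := by
      intro x'
      rw [Finset.sum_comm]
      refine Fintype.sum_equiv (Equiv.subRight x') _ _ (fun x => ?_)
      refine Fintype.sum_equiv (Equiv.addLeft (x' : L)) _ _ (fun c => ?_)
      simp only [Equiv.subRight_apply, Equiv.coe_addLeft, AddSubgroup.coe_sub]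
      congr 2
      ring
    rw [Finset.sum_congr rfl (fun x' _ => e3 x'), Finset.sum_const, nsmul_eq_mul, Finset.card_univ]
  have h4 : ∑ c : L, ‖∑ x : V, Φ (x + c)‖ ^ 2 =
      (Fintype.card V : ℝ) * ‖∑ h : V, ∑ c : L, Φ (c + h) * conj (Φ c)‖ := by
    have := congrArg norm h3
    rw [norm_mul, Complex.norm_natCast, Complex.norm_real, Real.norm_eq_abs,
      abs_of_nonneg (Finset.sum_nonneg fun _ _ => by positivity)] at this
    exact this
  rw [h4] at h2
  exact le_of_mul_le_mul_left h2 hVpos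

lemma conj_char (θ : MulChar L ℂ) (d E j : ℕ) (hdE : Fintype.card L = d * E + 1) (hd : 1 < d)
    (z : L) : (starRingEnd ℂ) ((θ ^ (E * j)) z) = (θ ^ (E * j)) (z ^ (d - 1)) := by
  by_cases hz : z = 0
  · subst hz
    rw [zero_pow (by omega), MulChar.map_zero, map_zero]
  · set w := (θ ^ (E * j)) z with hw
    have hzu : z = ((Units.mk0 z hz : Lˣ) : L) := rfl
    have h1 : w ^ d = 1 := by
      rw [hw, hzu, MulChar.pow_apply_coe, ← hzu, ← pow_mul, ← map_pow]
      have : z ^ (E * j * d) = 1 := by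
        have h := FiniteField.pow_card_sub_one_eq_one z hz
        rw [hdE, Nat.add_sub_cancel] at h
        rw [show E * j * d = d * E * j by ring, pow_mul, h, one_pow]
      rw [this, map_one]
    have hn : ‖w‖ = 1 := Complex.norm_eq_one_of_pow_eq_one h1 (by omega)
    have hw0 : w ≠ 0 := by intro h; rw [h, norm_zero] at hn; exact zero_ne_one hn
    rw [map_pow, ← hw, ← Complex.inv_eq_conj hn]
    apply inv_eq_of_mul_eq_one_right
    rw [← pow_succ', Nat.sub_add_cancel (by omega), h1]

lemma norm_char_eq_one (χ : MulChar L ℂ) (x : L) (hx : x ≠ 0) : ‖χ x‖ = 1 := by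
  have h1 : χ x ^ (Fintype.card L - 1) = 1 := by
    rw [← map_pow, FiniteField.pow_card_sub_one_eq_one x hx, map_one]
  have : Fintype.card L - 1 ≠ 0 := by
    have := Fintype.one_lt_card (α := L); omega
  exact Complex.norm_eq_one_of_pow_eq_one h1 this

lemma count_roots_inj {U : Type*} [Field U] [DecidableEq U] {ι : Type*} [DecidableEq ι]
    (S : Finset ι) (φ : ι → U)
    (hφ : Function.Injective φ) (P : U[X]) (hP : P ≠ 0) (D0 : ℕ) (hD : P.natDegree ≤ D0) :
    (S.filter fun h => P.eval (φ h) = 0).card ≤ D0 := by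
  have : (S.filter fun h => P.eval (φ h) = 0).image φ ⊆ P.roots.toFinset := by
    intro u hu
    simp only [Finset.mem_image, Finset.mem_filter] at hu
    obtain ⟨h, ⟨_, hh⟩, rfl⟩ := hu
    rw [Multiset.mem_toFinset, mem_roots hP]
    exact hh
  rw [← Finset.card_image_of_injective _ hφ]
  exact (Finset.card_le_card this).trans ((Multiset.toFinset_card_le _).trans
        ((card_roots' _).trans hD))

theorem mixed_bound (θ : MulChar L ℂ) (hθ : Faithful θ)
    (d E D0 μ k i j : ℕ) (hdE : Fintype.card L = d * E + 1) (P : L[X])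
    (P0 : (AlgebraicClosure L)[X]) (ρ : AlgebraicClosure L) (hρ : ρ ≠ 0)
    (hP : P.map (algebraMap L (AlgebraicClosure L)) = (X - C ρ) ^ k * P0)
    (hP0 : P0.eval ρ ≠ 0) (hk : k.Coprime d) (hPD : P.natDegree ≤ D0) (hμ : 1 ≤ μ)
    (hE : (4 + d * (2 * d * D0)) * μ ^ 2 + 1 ≤ E) (hj : 0 < j) (hjd : j < d)
    (V : AddSubgroup L) [Fintype V] :
    ‖∑ x : V, (θ ^ (E * i)) (x : L) * (θ ^ (E * j)) (P.eval (x : L))‖ ^ 2 ≤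
      (Fintype.card L : ℝ) + √((Fintype.card L : ℝ) * ((Fintype.card L : ℝ) ^ 2 *
        ((Fintype.card L : ℝ) * (2 * d * D0 + 2) / μ + 2 * d * D0) +
          3 * D0 * (Fintype.card L : ℝ) * (Fintype.card L : ℝ))) := by
  classical
  set Q := Fintype.card L with hQ
  set ι := algebraMap L (AlgebraicClosure L) with hι
  set T1 : ℝ := (Q : ℝ) * (2 * d * D0 + 2) / μ + 2 * d * D0 with hT1
  have hT1' : 0 ≤ T1 := by positivity
  set a := θ ^ (E * i)
  set b := θ ^ (E * j) with hb
  have hd1 : 1 < d := by omega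
  set H : Finset L := (Finset.univ.map ⟨((↑) : V → L), Subtype.val_injective⟩).erase 0 with hH
  have hHcard : H.card ≤ Q := by rw [hQ, ← Finset.card_univ]; exact Finset.card_le_univ _
  let ψ : L → L → ℂ := fun h y => b (P.eval (h * y + h) * P.eval (h * y) ^ (d - 1))
  let ω : L → ℂ := fun y => a (y + 1) * (starRingEnd ℂ) (a y)
  refine (coset_cauchy (fun x => a x * b (P.eval x)) V).trans ?_
  -- split off h = 0
  have hPne : P.map ι ≠ 0 := by
    rw [hP]
    refine mul_ne_zero (pow_ne_zero _ (X_sub_C_ne_zero ρ)) ?_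
    rintro rfl; simp at hP0
  have hPdeg : (P.map ι).natDegree ≤ D0 := by simpa using hPD
  have hsplit : ∑ h : V, ∑ c : L, (a (c + h) * b (P.eval (c + h))) *
      (starRingEnd ℂ) (a c * b (P.eval c)) =
      ∑ c : L, (a c * b (P.eval c)) * (starRingEnd ℂ) (a c * b (P.eval c)) +
      ∑ h ∈ H, ∑ y : L, ω y * ψ h y := by
    have e1 : ∑ h : V, ∑ c : L, (a (c + h) * b (P.eval (c + h))) *
      (starRingEnd ℂ) (a c * b (P.eval c)) =
      ∑ h ∈ (Finset.univ.map ⟨((↑) : V → L), Subtype.val_injective⟩ : Finset L),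
        ∑ c : L, (a (c + h) * b (P.eval (c + h))) *
      (starRingEnd ℂ) (a c * b (P.eval c)) := by
      rw [Finset.sum_map]; rfl
    rw [e1, ← Finset.add_sum_erase _ _ (a := (0 : L)) (by simp [V.zero_mem])]
    congr 1
    · simp
    · refine Finset.sum_congr rfl fun h hh => ?_
      have hh0 : h ≠ 0 := Finset.ne_of_mem_erase hh
      refine (Fintype.sum_equiv (Equiv.mulLeft₀ h hh0) _ _ fun y => ?_).symm
      simp only [Equiv.mulLeft₀_apply, ω, ψ]
      rw [map_mul b, ← conj_char θ d E j hdE hd1, map_mul (starRingEnd ℂ),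
        show h * y + h = h * (y + 1) by ring, map_mul a, map_mul a, map_mul (starRingEnd ℂ)]
      have hn : a h * (starRingEnd ℂ) (a h) = 1 := by
        rw [Complex.mul_conj', norm_char_eq_one a h hh0]; simp
      linear_combination -(a (y + 1) * b (eval (h * (y + 1)) P) * (starRingEnd ℂ) (a y) *
        (starRingEnd ℂ) (b (eval (h * y) P))) * hn
  rw [hsplit]
  refine (norm_add_le _ _).trans (add_le_add ?_ ?_)
  · refine (norm_sum_le _ _).trans ?_
    have : ∀ c ∈ (Finset.univ : Finset L),
      ‖(a c * b (P.eval c)) * (starRingEnd ℂ) (a c * b (P.eval c))‖ ≤ 1 := by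
      intro c _
      rw [norm_mul, RCLike.norm_conj, norm_mul]
      have h1 := norm_mulChar_le a c
      have h2 := norm_mulChar_le b (P.eval c)
      have h3 : ‖a c‖ * ‖b (P.eval c)‖ ≤ 1 := mul_le_one₀ h1 (norm_nonneg _) h2
      exact mul_le_one₀ h3 (by positivity) h3
    refine (Finset.sum_le_sum this).trans ?_
    simp [hQ]
  · apply Real.le_sqrt_of_sq_le
    rw [Finset.sum_comm]
    have hω : ∀ y, ‖ω y‖ ≤ 1 := by
      intro y
      simp only [ω]
      rw [norm_mul, RCLike.norm_conj]
      exact mul_le_one₀ (norm_mulChar_le a _) (norm_nonneg _) (norm_mulChar_le a _)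
    have h1 : ‖∑ y : L, ∑ h ∈ H, ω y * ψ h y‖ ≤ ∑ y : L, ‖∑ h ∈ H, ψ h y‖ := by
      refine (norm_sum_le _ _).trans (Finset.sum_le_sum fun y _ => ?_)
      rw [← Finset.mul_sum, norm_mul]
      exact mul_le_of_le_one_left (norm_nonneg _) (hω y)
    have h2 : ‖∑ y : L, ∑ h ∈ H, ω y * ψ h y‖ ^ 2 ≤ Q * ∑ y : L, ‖∑ h ∈ H, ψ h y‖ ^ 2 := by
      refine (pow_le_pow_left₀ (norm_nonneg _) h1 2).trans ?_
      have := sq_sum_le_card_mul_sum_sq (s := (Finset.univ : Finset L))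
        (f := fun y => ‖∑ h ∈ H, ψ h y‖)
      rwa [Finset.card_univ] at this
    refine h2.trans (mul_le_mul_of_nonneg_left ?_ (by positivity))
    -- expand the square
    let F : L → L → L[X] := fun h h' =>
      P.comp (C h * X + C h) * (P.comp (C h * X) ^ (d - 1) * P.comp (C h' * X) *
        P.comp (C h' * X + C h') ^ (d - 1))
    have hFev : ∀ h h' y, (F h h').eval y = P.eval (h * y + h) * (P.eval (h * y) ^ (d - 1) *
        P.eval (h' * y) * P.eval (h' * y + h') ^ (d - 1)) := by
      intro h h' y
      simp [F]
    have hψ : ∀ h h' y, ψ h y * (starRingEnd ℂ) (ψ h' y) = b ((F h h').eval y) := by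
      intro h h' y
      have hcc : ∀ z, (starRingEnd ℂ) (b (z ^ (d - 1))) = b z := by
        intro z
        rw [← conj_char θ d E j hdE hd1, Complex.conj_conj]
      rw [hFev]
      simp only [ψ]
      rw [map_mul b, map_mul b, map_mul (starRingEnd ℂ), hcc, conj_char θ d E j hdE hd1, ← hb,
        map_mul b, map_mul b, map_mul b]
      ring
    have hexp : ∑ y : L, ‖∑ h ∈ H, ψ h y‖ ^ 2 ≤
        ∑ h ∈ H, ∑ h' ∈ H, ‖∑ y : L, b ((F h h').eval y)‖ := by
      have e1 : ((∑ y : L, ‖∑ h ∈ H, ψ h y‖ ^ 2 : ℝ) : ℂ) =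
          ∑ h ∈ H, ∑ h' ∈ H, ∑ y : L, b ((F h h').eval y) := by
        push_cast
        have : ∀ y : L, ((‖∑ h ∈ H, ψ h y‖ : ℂ)) ^ 2 =
            ∑ h ∈ H, ∑ h' ∈ H, b ((F h h').eval y) := by
          intro y
          rw [← Complex.mul_conj', map_sum, Finset.sum_mul_sum]
          exact Finset.sum_congr rfl fun h _ => Finset.sum_congr rfl fun h' _ => hψ h h' y
        rw [Finset.sum_congr rfl fun y _ => this y, Finset.sum_comm]
        exact Finset.sum_congr rfl fun h _ => Finset.sum_comm
      have e2 := congrArg norm e1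
      rw [Complex.norm_real, Real.norm_eq_abs,
        abs_of_nonneg (Finset.sum_nonneg fun _ _ => by positivity)] at e2
      rw [e2]
      refine (norm_sum_le _ _).trans (Finset.sum_le_sum fun h _ => ?_)
      exact norm_sum_le _ _
    refine hexp.trans ?_
    let bad : L → L → Prop := fun h h' => (P.map ι).eval (ρ - ι h) = 0 ∨
      (P.map ι).eval (ι h' * (ρ / ι h - 1)) = 0 ∨ (P.map ι).eval (ι h' * (ρ / ι h)) = 0
    have hgood : ∀ h ∈ H, ∀ h' ∈ H, ¬ bad h h' → ‖∑ y : L, b ((F h h').eval y)‖ ≤ T1 := by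
      intro h hh h' hh' hbad
      have hh0 : h ≠ 0 := Finset.ne_of_mem_erase hh
      have hih : ι h ≠ 0 := by simpa [hι] using hh0
      simp only [bad, not_or] at hbad
      obtain ⟨hb1, hb2, hb3⟩ := hbad
      set R : (AlgebraicClosure L)[X] := ((P.map ι).comp (C (ι h) * X) ^ (d - 1) *
        (P.map ι).comp (C (ι h') * X) *
        (P.map ι).comp (C (ι h') * X + C (ι h')) ^ (d - 1)) with hR
      have hFmap : (F h h').map ι = (X - C (ρ / ι h - 1)) ^ k *
          (C (ι h ^ k) * P0.comp (C (ι h) * X + C (ι h)) * R) := by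
        have e : (P.map ι).comp (C (ι h) * X + C (ι h)) = (X - C (ρ / ι h - 1)) ^ k *
          (C (ι h ^ k) * P0.comp (C (ι h) * X + C (ι h))) := by
          rw [hP, mul_comp, pow_comp, sub_comp, X_comp, C_comp]
          have : (C (ι h) * X + C (ι h) - C ρ) = C (ι h) * (X - C (ρ / ι h - 1)) := by
            have h2 : C (ι h) * C (ρ / ι h - 1) = C (ρ - ι h) := by
              rw [← C_mul]; congr 1; field_simp
            rw [mul_sub, h2, C_sub]; ring
          rw [this, mul_pow, C_pow]; ring
        have hm : (F h h').map ι = (P.map ι).comp (C (ι h) * X + C (ι h)) * R := by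
          simp only [F, hR, Polynomial.map_mul, Polynomial.map_pow, Polynomial.map_comp,
            Polynomial.map_add, Polynomial.map_C, Polynomial.map_X]
        rw [hm, e]; ring
      have hdeg : (F h h').natDegree ≤ 2 * d * D0 := by
        have c1 : ∀ u v : L, (P.comp (C u * X + C v)).natDegree ≤ D0 := by
          intro u v
          refine natDegree_comp_le.trans ?_
          calc P.natDegree * (C u * X + C v).natDegree ≤ D0 * 1 :=
                Nat.mul_le_mul hPD natDegree_linear_le
            _ = D0 := mul_one _
        have c2 : ∀ u : L, (P.comp (C u * X)).natDegree ≤ D0 := by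
          intro u
          simpa using c1 u 0
        have c3 : ∀ (A : L[X]), A.natDegree ≤ D0 → (A ^ (d - 1)).natDegree ≤ (d - 1) * D0 :=
          fun A hA => natDegree_pow_le.trans (Nat.mul_le_mul_left _ hA)
        have : (F h h').natDegree ≤ D0 + ((d - 1) * D0 + D0 + (d - 1) * D0) := by
          refine natDegree_mul_le.trans (add_le_add (c1 _ _) ?_)
          refine natDegree_mul_le.trans (add_le_add ?_ (c3 _ (c1 _ _)))
          exact natDegree_mul_le.trans (add_le_add (c3 _ (c2 _)) (c2 _))
        refine this.trans ?_
        obtain ⟨e, rfl⟩ : ∃ e, d = e + 1 := ⟨d - 1, by omega⟩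
        rw [Nat.add_sub_cancel]
        nlinarith
      have := pure_bound θ hθ d E (2 * d * D0) μ k j hdE (F h h') _ _ hFmap (by
        have e2 : ι h * (ρ / ι h - 1) = ρ - ι h := by field_simp
        have e3 : ι h' * (ρ / ι h - 1) + ι h' = ι h' * (ρ / ι h) := by ring
        simp only [hR, eval_mul, eval_pow, eval_C, eval_comp, eval_add, eval_X, e2, e3, sub_add_cancel]
        refine mul_ne_zero (mul_ne_zero (pow_ne_zero _ hih) hP0) ?_
        exact mul_ne_zero (mul_ne_zero (pow_ne_zero _ hb1) hb2) (pow_ne_zero _ hb3))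
        hk hdeg hμ hE hj hjd
      rw [hT1]
      push_cast at this
      exact this
    have htriv : ∀ h h', ‖∑ y : L, b ((F h h').eval y)‖ ≤ Q := by
      intro h h'
      refine (norm_sum_le _ _).trans ((Finset.sum_le_sum fun y _ => norm_mulChar_le b _).trans ?_)
      simp [hQ]
    have hcount : ∀ h ∈ H, ((H.filter fun h' => bad h h').card : ℝ) ≤
        (if (P.map ι).eval (ρ - ι h) = 0 then (Q : ℝ) else 0) + 2 * D0 := by
      intro h hh
      have hh0 : h ≠ 0 := Finset.ne_of_mem_erase hh
      have hih : ι h ≠ 0 := by simpa [hι] using hh0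
      split_ifs with hz
      · have : ((H.filter fun h' => bad h h').card : ℝ) ≤ Q := by
          exact_mod_cast (Finset.card_filter_le _ _).trans hHcard
        have : (0 : ℝ) ≤ 2 * D0 := by positivity
        linarith
      · have hsub : (H.filter fun h' => bad h h') ⊆
            (H.filter fun h' => (P.map ι).eval (ι h' * (ρ / ι h - 1)) = 0) ∪
            (H.filter fun h' => (P.map ι).eval (ι h' * (ρ / ι h)) = 0) := by
          intro h' hh'
          simp only [Finset.mem_filter, bad, hz, false_or] at hh'
          simp only [Finset.mem_union, Finset.mem_filter]
          tauto
        have inj : ∀ t : AlgebraicClosure L, t ≠ 0 → Function.Injective fun h' : L => ι h' * t := by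
          intro t ht x y hxy
          exact ι.injective (mul_right_cancel₀ ht hxy)
        have c1 : (H.filter fun h' => (P.map ι).eval (ι h' * (ρ / ι h)) = 0).card ≤ D0 :=
          count_roots_inj H (fun h' => ι h' * (ρ / ι h)) (inj _ (div_ne_zero hρ hih)) _ hPne D0 hPdeg
        have c2 : (H.filter fun h' => (P.map ι).eval (ι h' * (ρ / ι h - 1)) = 0).card ≤ D0 := by
          by_cases ht : ρ / ι h - 1 = 0
          · rw [Finset.filter_false_of_mem]
            · simp
            · intro h' _
              rw [ht, mul_zero]
              have : ρ - ι h = 0 := by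
                have e2 : ι h * (ρ / ι h - 1) = ρ - ι h := by field_simp
                rw [← e2, ht, mul_zero]
              rwa [this] at hz
          · exact count_roots_inj H (fun h' => ι h' * (ρ / ι h - 1)) (inj _ ht) _ hPne D0 hPdeg
        have := (Finset.card_le_card hsub).trans (Finset.card_union_le _ _)
        have h5 : (H.filter fun h' => bad h h').card ≤ 2 * D0 := by omega
        rw [zero_add]
        exact_mod_cast h5
    have hbadh : ((H.filter fun h => (P.map ι).eval (ρ - ι h) = 0).card : ℝ) ≤ D0 := by
      have := count_roots_inj H (fun h => ρ - ι h)
        (fun x y hxy => ι.injective (sub_right_injective hxy)) _ hPne D0 hPdeg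
      exact_mod_cast this
    calc ∑ h ∈ H, ∑ h' ∈ H, ‖∑ y : L, b ((F h h').eval y)‖
        ≤ ∑ h ∈ H, ∑ h' ∈ H, (T1 + if bad h h' then (Q : ℝ) else 0) := by
          refine Finset.sum_le_sum fun h hh => Finset.sum_le_sum fun h' hh' => ?_
          split_ifs with hbad
          · have := htriv h h'; linarith
          · have := hgood h hh h' hh' hbad; linarith
      _ = ∑ h ∈ H, (H.card * T1 + (H.filter fun h' => bad h h').card * (Q : ℝ)) := by
          refine Finset.sum_congr rfl fun h _ => ?_
          rw [Finset.sum_add_distrib, ← Finset.sum_filter, Finset.sum_const, Finset.sum_const,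
            nsmul_eq_mul, nsmul_eq_mul]
      _ ≤ ∑ h ∈ H, (H.card * T1 + ((if (P.map ι).eval (ρ - ι h) = 0 then (Q : ℝ) else 0)
            + 2 * D0) * (Q : ℝ)) := by
          refine Finset.sum_le_sum fun h hh => ?_
          have := mul_le_mul_of_nonneg_right (hcount h hh) (Nat.cast_nonneg (α := ℝ) Q)
          linarith
      _ = H.card * (H.card * T1) +
            ((H.filter fun h => (P.map ι).eval (ρ - ι h) = 0).card * (Q : ℝ) +
              H.card * (2 * D0)) * Q := by
          rw [Finset.sum_add_distrib, ← Finset.sum_mul, ← Finset.sum_mul, Finset.sum_add_distrib,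
            ← Finset.sum_filter]
          simp only [Finset.sum_const, nsmul_eq_mul, mul_assoc]
      _ ≤ (Q : ℝ) ^ 2 * T1 + 3 * D0 * Q * Q := by
          have hH' : (H.card : ℝ) ≤ Q := by exact_mod_cast hHcard
          have a1 : (H.card : ℝ) * (H.card * T1) ≤ Q ^ 2 * T1 := by
            rw [← mul_assoc, sq]
            exact mul_le_mul_of_nonneg_right (mul_le_mul hH' hH' (by positivity) (by positivity)) hT1'
          have a2 : ((H.filter fun h => (P.map ι).eval (ρ - ι h) = 0).card * (Q : ℝ) +
              H.card * (2 * D0)) ≤ D0 * Q + Q * (2 * D0) := by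
            gcongr
          have a3 := mul_le_mul_of_nonneg_right a2 (Nat.cast_nonneg (α := ℝ) Q)
          linarith

end Mixed


section Equi

variable {L : Type} [Field L] [Fintype L]

lemma faithful_pow_ne_one (θ : MulChar L ℂ) (hθ : Faithful θ) (d E i : ℕ)
    (hdE : Fintype.card L = d * E + 1) (hi : 0 < i) (hid : i < d) : θ ^ (E * i) ≠ 1 := by
  classical
  intro h
  obtain ⟨g, hg⟩ := IsCyclic.exists_generator (α := Lˣ)
  have ho : orderOf g = Fintype.card L - 1 := by
    rw [orderOf_eq_card_of_forall_mem_zpowers hg, Nat.card_eq_fintype_card, Fintype.card_units]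
  have h1 : θ ((g : L) ^ (E * i)) = 1 := by
    rw [map_pow, ← MulChar.pow_apply_coe, h, MulChar.one_apply_coe]
  have h2 := hθ _ h1
  have h3 : g ^ (E * i) = 1 := by ext; push_cast; exact h2
  have h4 := orderOf_dvd_of_pow_eq_one h3
  rw [ho, hdE, Nat.add_sub_cancel] at h4
  have hE : 0 < E := by
    rcases Nat.eq_zero_or_pos E with h0 | h0
    · have := Fintype.one_lt_card (α := L)
      rw [hdE, h0] at this; omega
    · exact h0
  have h5 := Nat.le_of_dvd (Nat.mul_pos hE hi) h4
  have : E * i < E * d := Nat.mul_lt_mul_of_pos_left hid hE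
  rw [mul_comm d E] at h5
  omega

lemma single_bound (χ : MulChar L ℂ) (hχ : χ ≠ 1) (V : AddSubgroup L) [Fintype V] :
    ‖∑ x : V, χ (x : L)‖ ^ 2 ≤ 2 * (Fintype.card L : ℝ) := by
  classical
  refine (coset_cauchy (fun x => χ x) V).trans ?_
  set H : Finset L := (Finset.univ.map ⟨((↑) : V → L), Subtype.val_injective⟩).erase 0 with hH
  have hHcard : H.card ≤ Fintype.card L := by rw [← Finset.card_univ]; exact Finset.card_le_univ _
  have e1 : ∑ h : V, ∑ c : L, χ (c + h) * (starRingEnd ℂ) (χ c) =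
      ∑ h ∈ (Finset.univ.map ⟨((↑) : V → L), Subtype.val_injective⟩ : Finset L),
        ∑ c : L, χ (c + h) * (starRingEnd ℂ) (χ c) := by
    rw [Finset.sum_map]; rfl
  rw [e1, ← Finset.add_sum_erase _ _ (a := (0 : L)) (by simp)]
  refine (norm_add_le _ _).trans ?_
  have b1 : ‖∑ c : L, χ (c + 0) * (starRingEnd ℂ) (χ c)‖ ≤ Fintype.card L := by
    refine (norm_sum_le _ _).trans ?_
    refine (Finset.sum_le_sum (g := fun _ => (1 : ℝ)) fun c _ => ?_).trans (by simp)
    rw [norm_mul, RCLike.norm_conj]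
    exact mul_le_one₀ (norm_mulChar_le χ _) (norm_nonneg _) (norm_mulChar_le χ _)
  have b2 : ∀ h ∈ H, ‖∑ c : L, χ (c + h) * (starRingEnd ℂ) (χ c)‖ ≤ 1 := by
    intro h hh
    have hh0 : h ≠ 0 := Finset.ne_of_mem_erase hh
    have hconj : ∀ c : L, c ≠ 0 → (starRingEnd ℂ) (χ c) = χ (c⁻¹) := by
      intro c hc
      rw [← Complex.inv_eq_conj (norm_char_eq_one χ c hc), ← MulChar.inv_apply',
        MulChar.inv_apply_eq_inv']
    have key : ∑ c : L, χ (c + h) * (starRingEnd ℂ) (χ c) = - χ 1 := by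
      have s0 : ∑ u : L, χ u = 0 := MulChar.sum_eq_zero_of_ne_one hχ
      rw [← Finset.add_sum_erase _ _ (Finset.mem_univ (1 : L))] at s0
      rw [eq_neg_of_add_eq_zero_right s0 |>.symm,
        ← Finset.add_sum_erase _ _ (Finset.mem_univ (0 : L)), MulChar.map_zero, map_zero, mul_zero,
        zero_add]
      refine Finset.sum_bij' (fun c _ => 1 + h * c⁻¹) (fun u _ => h * (u - 1)⁻¹) ?_ ?_ ?_ ?_ ?_
      · intro c hc
        have hc0 := Finset.ne_of_mem_erase hc
        simp [hh0, hc0]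
      · intro u hu
        have hu0 := Finset.ne_of_mem_erase hu
        simp [hh0, sub_ne_zero.mpr hu0]
      · intro c hc
        have hc0 := Finset.ne_of_mem_erase hc
        field_simp
        rw [add_sub_cancel_left, div_self hh0]
      · intro u hu
        have hu0 := sub_ne_zero.mpr (Finset.ne_of_mem_erase hu)
        field_simp
        ring
      · intro c hc
        have hc0 := Finset.ne_of_mem_erase hc
        rw [hconj c hc0, ← map_mul]
        congr 1
        field_simp
    rw [key, norm_neg]
    exact norm_mulChar_le χ _
  have b3 : ‖∑ h ∈ H, ∑ c : L, χ (c + h) * (starRingEnd ℂ) (χ c)‖ ≤ Fintype.card L := by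
    refine (norm_sum_le _ _).trans ((Finset.sum_le_sum b2).trans ?_)
    rw [Finset.sum_const, nsmul_eq_mul, mul_one]
    exact_mod_cast hHcard
  linarith

lemma exists_gen : ∃ g : L, g ≠ 0 ∧ orderOf g = Fintype.card L - 1 := by
  classical
  obtain ⟨g, hg⟩ := IsCyclic.exists_generator (α := Lˣ)
  refine ⟨g, g.ne_zero, ?_⟩
  rw [orderOf_units, orderOf_eq_card_of_forall_mem_zpowers hg, Nat.card_eq_fintype_card,
    Fintype.card_units]

lemma card_roots_unity [DecidableEq L] (d E : ℕ) (hdE : Fintype.card L = d * E + 1) :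
    (Finset.univ.filter fun u : L => u ^ E = 1).card = E := by
  have hcard := Fintype.one_lt_card (α := L)
  have hE : 0 < E := by
    rcases Nat.eq_zero_or_pos E with h0 | h0
    · rw [hdE, h0] at hcard; omega
    · exact h0
  have hd : 0 < d := by
    rcases Nat.eq_zero_or_pos d with h0 | h0
    · rw [hdE, h0] at hcard; omega
    · exact h0
  obtain ⟨g, hg0, hg⟩ := exists_gen (L := L)
  have hprim : IsPrimitiveRoot g (d * E) := by
    rw [IsPrimitiveRoot.iff_orderOf, hg, hdE, Nat.add_sub_cancel]
  have h2 : IsPrimitiveRoot (g ^ d) E := hprim.pow (Nat.mul_pos hd hE) rfl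
  have := h2.card_nthRootsFinset
  refine Eq.trans ?_ this
  congr 1
  ext u
  simp [mem_nthRootsFinset hE]

/-- Fourier expansion -/
lemma fourier_indicator [DecidableEq L] (θ : MulChar L ℂ) (hθ : Faithful θ) (d E : ℕ)
    (hdE : Fintype.card L = d * E + 1) (A : Finset L) (hA0 : (0 : L) ∉ A)
    (hA : ∀ x ∈ A, ∀ u : L, u ^ E = 1 → u * x ∈ A) :
    ∃ a : ℕ → ℂ, a 0 = (A.card : ℂ) / ((Fintype.card L : ℂ) - 1) ∧ (∀ i, ‖a i‖ ≤ 1) ∧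
      ∀ x : L, (if x ∈ A then (1 : ℂ) else 0) = ∑ i ∈ Finset.range d, a i * (θ ^ (E * i)) x := by
  have hcard := Fintype.one_lt_card (α := L)
  have hE : 0 < E := by
    rcases Nat.eq_zero_or_pos E with h0 | h0
    · rw [hdE, h0] at hcard; omega
    · exact h0
  have hd : 0 < d := by
    rcases Nat.eq_zero_or_pos d with h0 | h0
    · rw [hdE, h0] at hcard; omega
    · exact h0
  have hQ1 : (Fintype.card L : ℂ) - 1 = d * E := by rw [hdE]; push_cast; ring
  have hdE0 : (d * E : ℂ) ≠ 0 := by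
    have : d * E ≠ 0 := by positivity
    exact_mod_cast this
  refine ⟨fun i => (∑ y ∈ A, (θ ^ (E * i)) y⁻¹) / (d * E), ?_, ?_, ?_⟩
  · simp only [mul_zero, pow_zero]
    rw [hQ1]
    congr 1
    rw [Finset.sum_congr rfl (g := fun _ => (1 : ℂ)), Finset.sum_const, nsmul_eq_mul, mul_one]
    intro y hy
    have hy0 : y ≠ 0 := fun h => hA0 (h ▸ hy)
    exact MulChar.one_apply (IsUnit.mk0 _ (inv_ne_zero hy0))
  · intro i
    simp only
    rw [norm_div]
    apply div_le_one_of_le₀ _ (norm_nonneg _)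
    refine (norm_sum_le _ _).trans ((Finset.sum_le_sum fun y _ => norm_mulChar_le _ _).trans ?_)
    rw [Finset.sum_const, nsmul_eq_mul, mul_one, ← Nat.cast_mul, Complex.norm_natCast]
    have : A.card ≤ d * E := by
      have h1 : A ⊆ Finset.univ.erase 0 := fun y hy =>
        Finset.mem_erase.mpr ⟨fun h => hA0 (h ▸ hy), Finset.mem_univ _⟩
      have := Finset.card_le_card h1
      rw [Finset.card_erase_of_mem (Finset.mem_univ _), Finset.card_univ, hdE] at this
      simpa using this
    exact_mod_cast this
  · intro x
    simp only
    by_cases hx : x = 0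
    · subst hx
      rw [if_neg hA0, Finset.sum_eq_zero]
      intro i _
      rw [MulChar.map_zero, mul_zero]
    have e1 : ∑ i ∈ Finset.range d, (∑ y ∈ A, (θ ^ (E * i)) y⁻¹) / (d * E) * (θ ^ (E * i)) x =
        (∑ y ∈ A, ∑ i ∈ Finset.range d, (θ ((y⁻¹ * x) ^ E)) ^ i) / (d * E) := by
      rw [Finset.sum_comm, Finset.sum_div]
      refine Finset.sum_congr rfl fun i _ => ?_
      rw [div_mul_eq_mul_div, Finset.sum_mul]
      congr 1
      refine Finset.sum_congr rfl fun y hy => ?_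
      have hy0 : y ≠ 0 := fun h => hA0 (h ▸ hy)
      have hyx : y⁻¹ * x ≠ 0 := mul_ne_zero (inv_ne_zero hy0) hx
      rw [← map_mul, ← map_pow, ← pow_mul, map_pow]
      exact MulChar.pow_apply_coe θ _ (Units.mk0 _ hyx)
    have e2 : ∀ y ∈ A, ∑ i ∈ Finset.range d, (θ ((y⁻¹ * x) ^ E)) ^ i =
        if (y⁻¹ * x) ^ E = 1 then (d : ℂ) else 0 := by
      intro y hy
      have hy0 : y ≠ 0 := fun h => hA0 (h ▸ hy)
      have hyx : y⁻¹ * x ≠ 0 := mul_ne_zero (inv_ne_zero hy0) hx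
      split_ifs with h
      · rw [h, map_one]; simp
      · have hne : θ ((y⁻¹ * x) ^ E) ≠ 1 := fun h' => h (hθ _ h')
        rw [geom_sum_eq hne, ← map_pow, ← pow_mul]
        have := FiniteField.pow_card_sub_one_eq_one _ hyx
        rw [hdE, Nat.add_sub_cancel, mul_comm d E] at this
        rw [this, map_one, sub_self, zero_div]
    rw [e1, Finset.sum_congr rfl e2, ← Finset.sum_filter, Finset.sum_const, nsmul_eq_mul]
    split_ifs with hxA
    · have : (A.filter fun y => (y⁻¹ * x) ^ E = 1).card = E := by
        conv_rhs => rw [← card_roots_unity d E hdE]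
        refine Finset.card_bij' (fun y _ => y⁻¹ * x) (fun u _ => u⁻¹ * x) ?_ ?_ ?_ ?_
        · intro y hy
          simpa using (Finset.mem_filter.mp hy).2
        · intro u hu
          have hu1 : u ^ E = 1 := by simpa using hu
          have hu0 : u ≠ 0 := by
            rintro rfl
            rw [zero_pow hE.ne'] at hu1
            exact zero_ne_one hu1
          refine Finset.mem_filter.mpr ⟨hA x hxA _ (by rw [inv_pow, hu1, inv_one]), ?_⟩
          rw [mul_inv, inv_inv, mul_assoc, inv_mul_cancel₀ hx, mul_one, hu1]
        · intro y hy
          have hy0 : y ≠ 0 := fun h => hA0 (h ▸ (Finset.mem_filter.mp hy).1)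
          field_simp
        · intro u hu
          rw [mul_inv, inv_inv, mul_assoc, inv_mul_cancel₀ hx, mul_one]
      rw [this, mul_comm, div_self hdE0]
    · rw [Finset.filter_false_of_mem]
      · simp
      · intro y hy h
        apply hxA
        have := hA y hy _ h
        have hy0 : y ≠ 0 := fun h => hA0 (h ▸ hy)
        rwa [show y⁻¹ * x * y = x by field_simp] at this

lemma equidist [DecidableEq L] (θ : MulChar L ℂ) (hθ : Faithful θ) (d E : ℕ)
    (hdE : Fintype.card L = d * E + 1) (P : L[X]) (Z : ℕ)
    (hZ : (Finset.univ.filter fun x : L => x = 0 ∨ P.eval x = 0).card ≤ Z)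
    (A B : Finset L) (hA0 : (0 : L) ∉ A) (hB0 : (0 : L) ∉ B)
    (hA : ∀ x ∈ A, ∀ u : L, u ^ E = 1 → u * x ∈ A)
    (hB : ∀ x ∈ B, ∀ u : L, u ^ E = 1 → u * x ∈ B)
    (V : AddSubgroup L) [Fintype V] (T : ℝ) (hT0 : 0 ≤ T)
    (hT : ∀ i j, i < d → j < d → ¬ (i = 0 ∧ j = 0) →
      ‖∑ x : V, (θ ^ (E * i)) (x : L) * (θ ^ (E * j)) (P.eval (x : L))‖ ≤ T) :
    |((Finset.univ.filter fun x : V => (x : L) ∈ A ∧ P.eval (x : L) ∈ B).card : ℝ) -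
      Fintype.card V * ((A.card / ((Fintype.card L : ℝ) - 1)) *
        (B.card / ((Fintype.card L : ℝ) - 1)))| ≤ d ^ 2 * T + Z := by
  obtain ⟨a, ha0, ha1, ha⟩ := fourier_indicator θ hθ d E hdE A hA0 hA
  obtain ⟨b, hb0, hb1, hb⟩ := fourier_indicator θ hθ d E hdE B hB0 hB
  have hcard := Fintype.one_lt_card (α := L)
  have hd : 0 < d := by
    rcases Nat.eq_zero_or_pos d with h0 | h0
    · rw [hdE, h0] at hcard; omega
    · exact h0
  let S : ℕ × ℕ → ℂ := fun p =>
    ∑ x : V, (θ ^ (E * p.1)) (x : L) * (θ ^ (E * p.2)) (P.eval (x : L))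
  have e1 : ((Finset.univ.filter fun x : V => (x : L) ∈ A ∧ P.eval (x : L) ∈ B).card : ℂ) =
      ∑ p ∈ Finset.range d ×ˢ Finset.range d, a p.1 * b p.2 * S p := by
    rw [Finset.card_filter]
    push_cast
    simp only [S, Finset.mul_sum]
    rw [Finset.sum_comm]
    refine Finset.sum_congr rfl fun x _ => ?_
    have : (if (x : L) ∈ A ∧ P.eval (x : L) ∈ B then (1 : ℂ) else 0) =
        (if (x : L) ∈ A then (1 : ℂ) else 0) * (if P.eval (x : L) ∈ B then (1 : ℂ) else 0) := by
      by_cases h1 : (x : L) ∈ A <;> by_cases h2 : P.eval (x : L) ∈ B <;> simp [h1, h2]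
    rw [this, ha, hb, Finset.sum_mul_sum, Finset.sum_product]
    refine Finset.sum_congr rfl fun i _ => Finset.sum_congr rfl fun j _ => ?_
    ring
  have hmem : ((0, 0) : ℕ × ℕ) ∈ Finset.range d ×ˢ Finset.range d := by simp [hd]
  rw [← Finset.add_sum_erase _ _ hmem] at e1
  have hrest : ‖∑ p ∈ (Finset.range d ×ˢ Finset.range d).erase (0, 0), a p.1 * b p.2 * S p‖ ≤
      d ^ 2 * T := by
    refine (norm_sum_le _ _).trans ?_
    have : ∀ p ∈ (Finset.range d ×ˢ Finset.range d).erase (0, 0), ‖a p.1 * b p.2 * S p‖ ≤ T := by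
      intro p hp
      rw [Finset.mem_erase, Finset.mem_product, Finset.mem_range, Finset.mem_range] at hp
      have hS : ‖S p‖ ≤ T := hT p.1 p.2 hp.2.1 hp.2.2 (fun h => hp.1 (Prod.ext h.1 h.2))
      rw [norm_mul, norm_mul]
      have h1 : ‖a p.1‖ * ‖b p.2‖ ≤ 1 := mul_le_one₀ (ha1 _) (norm_nonneg _) (hb1 _)
      exact (mul_le_of_le_one_left (norm_nonneg _) h1).trans hS
    refine (Finset.sum_le_card_nsmul _ _ _ this).trans ?_
    rw [nsmul_eq_mul]
    apply mul_le_mul_of_nonneg_right _ hT0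
    have := Finset.card_erase_le (s := Finset.range d ×ˢ Finset.range d) (a := (0, 0))
    rw [Finset.card_product, Finset.card_range, ← sq] at this
    exact_mod_cast this
  have hS0 : ‖S (0, 0) - Fintype.card V‖ ≤ Z := by
    have : S (0, 0) - Fintype.card V =
        ∑ x : V, (if (x : L) = 0 ∨ P.eval (x : L) = 0 then (-1 : ℂ) else 0) := by
      have h1 : (Fintype.card V : ℂ) = ∑ x : V, (1 : ℂ) := by simp
      rw [h1]
      simp only [S, mul_zero, pow_zero]
      rw [← Finset.sum_sub_distrib]
      refine Finset.sum_congr rfl fun x _ => ?_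
      by_cases h1 : (x : L) = 0
      · rw [if_pos (Or.inl h1), h1, MulChar.map_zero]; ring
      by_cases h2 : P.eval (x : L) = 0
      · rw [if_pos (Or.inr h2), h2, MulChar.map_zero]; ring
      rw [if_neg (by tauto), MulChar.one_apply (IsUnit.mk0 _ h1),
        MulChar.one_apply (IsUnit.mk0 _ h2)]
      ring
    rw [this, ← Finset.sum_filter, Finset.sum_const, nsmul_eq_mul, norm_mul, norm_neg, norm_one,
      mul_one, Complex.norm_natCast]
    have h2 : (Finset.univ.filter fun x : V => (x : L) = 0 ∨ P.eval (x : L) = 0).card ≤ Z := by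
      refine le_trans ?_ hZ
      refine Finset.card_le_card_of_injOn (fun x => (x : L)) ?_ Subtype.val_injective.injOn
      intro x hx
      simpa using hx
    exact_mod_cast h2
  have e2 : (((Finset.univ.filter fun x : V => (x : L) ∈ A ∧ P.eval (x : L) ∈ B).card : ℝ) -
      Fintype.card V * ((A.card / ((Fintype.card L : ℝ) - 1)) *
        (B.card / ((Fintype.card L : ℝ) - 1))) : ℝ) =
      a 0 * b 0 * (S (0, 0) - Fintype.card V) +
      ∑ p ∈ (Finset.range d ×ˢ Finset.range d).erase (0, 0), a p.1 * b p.2 * S p := by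
    push_cast
    rw [e1, ← ha0, ← hb0]
    ring
  have e3 := congrArg norm e2
  rw [Complex.norm_real, Real.norm_eq_abs] at e3
  rw [e3]
  refine (norm_add_le _ _).trans ?_
  have h4 : ‖a 0 * b 0 * (S (0, 0) - Fintype.card V)‖ ≤ Z := by
    rw [norm_mul, norm_mul]
    exact (mul_le_of_le_one_left (norm_nonneg _)
      (mul_le_one₀ (ha1 _) (norm_nonneg _) (hb1 _))).trans hS0
  linarith

open Classical in
lemma incl_excl {ι : Type*} (Vg : ι → AddSubgroup L) (p : L → Prop) (c err : ℝ)
    (h : ∀ V : AddSubgroup L, |((Finset.univ.filter fun x : L => x ∈ V ∧ p x).card : ℝ) -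
      (Finset.univ.filter fun x : L => x ∈ V).card * c| ≤ err) (G : Finset ι) :
    ∀ W : AddSubgroup L,
      |((Finset.univ.filter fun x : L => (x ∈ W ∧ ∀ g ∈ G, x ∉ Vg g) ∧ p x).card : ℝ) -
      (Finset.univ.filter fun x : L => x ∈ W ∧ ∀ g ∈ G, x ∉ Vg g).card * c| ≤
        2 ^ G.card * err := by
  induction G using Finset.induction_on with
  | empty => intro W; simpa using h W
  | insert g G hg ih =>
    intro W
    have key : ∀ r : L → Prop,
        ((Finset.univ.filter fun x : L => (x ∈ W ∧ ∀ g' ∈ insert g G, x ∉ Vg g') ∧ r x).card : ℝ) =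
        (Finset.univ.filter fun x : L => (x ∈ W ∧ ∀ g ∈ G, x ∉ Vg g) ∧ r x).card -
        (Finset.univ.filter fun x : L => (x ∈ W ⊓ Vg g ∧ ∀ g ∈ G, x ∉ Vg g) ∧ r x).card := by
      intro r
      rw [eq_sub_iff_add_eq, ← Nat.cast_add, ← Finset.card_union_of_disjoint]
      · congr 2
        ext x
        simp only [Finset.mem_union, Finset.mem_filter, Finset.mem_univ, true_and,
          AddSubgroup.mem_inf, Finset.forall_mem_insert]
        tauto
      · rw [Finset.disjoint_left]
        intro x hx hx'
        simp only [Finset.mem_filter, Finset.mem_univ, true_and,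
          AddSubgroup.mem_inf, Finset.forall_mem_insert] at hx hx'
        tauto
    have k1 := key p
    have k2 := key (fun _ => True)
    simp only [and_true] at k2
    rw [k1, k2, Finset.card_insert_of_notMem hg]
    have i1 := ih W
    have i2 := ih (W ⊓ Vg g)
    rw [abs_le] at i1 i2 ⊢
    rw [pow_succ]
    constructor <;> linarith [i1.1, i1.2, i2.1, i2.2]

end Equi


section PolyData

variable {L : Type} [Field L] [Fintype L]

/-- a nonzero geometric root of exact multiplicity prime to everything -/
def RootData (f₁ f₂ : L[X]) (k : ℕ) : Prop :=
  ∃ (ρ : AlgebraicClosure L) (P1 : (AlgebraicClosure L)[X]), ρ ≠ 0 ∧ P1.eval ρ ≠ 0 ∧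
    f₁.map (algebraMap L (AlgebraicClosure L)) = (X - C ρ) ^ k * P1 ∧
    (f₂.map (algebraMap L (AlgebraicClosure L))).eval ρ ≠ 0

lemma root_data_aux (f₁ f₂ g : L[X]) (hcop : IsCoprime f₁ f₂) (k : ℕ)
    (hgm : g.Monic) (hg : Irreducible g) (hgX : g ≠ X) (hgk : g ^ k ∣ f₁ * f₂)
    (hgk1 : ¬ g ^ (k + 1) ∣ f₁ * f₂) (hgf : g ∣ f₁) : RootData f₁ f₂ k := by
  set ι := algebraMap L (AlgebraicClosure L) with hι
  have hcg : IsCoprime g f₂ := hcop.of_isCoprime_of_dvd_left hgf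
  have h1 : g ^ k ∣ f₁ := (hcg.pow_left).dvd_of_dvd_mul_right hgk
  obtain ⟨h, hh⟩ := h1
  have hgh : ¬ g ∣ h := by
    rintro ⟨c, hc⟩
    apply hgk1
    rw [hh, hc]
    exact ⟨c * f₂, by ring⟩
  have hcgh : IsCoprime g h := (hg.coprime_iff_not_dvd).mpr hgh
  obtain ⟨ρ, hρ⟩ := IsAlgClosed.exists_eval₂_eq_zero ι g (by
    rw [Polynomial.degree_eq_natDegree hg.ne_zero]
    have := hg.natDegree_pos
    exact_mod_cast this.ne')
  have hρ' : (g.map ι).eval ρ = 0 := by rw [eval_map]; exact hρ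
  have hne : ∀ r : L[X], IsCoprime g r → (r.map ι).eval ρ ≠ 0 := by
    rintro r ⟨a, b, hab⟩ hr
    have := congrArg (fun s : L[X] => (s.map ι).eval ρ) hab
    simp [hρ', hr] at this
  obtain ⟨g1, hg1⟩ := dvd_iff_isRoot.mpr hρ'
  have hsep : g.Separable := PerfectField.separable_of_irreducible hg
  have hg1ρ : g1.eval ρ ≠ 0 := by
    have h2 := (hsep.map (f := ι)).eval₂_derivative_ne_zero (RingHom.id _) (x := ρ) (by
      rw [eval₂_id]; exact hρ')
    rw [eval₂_id, hg1] at h2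
    simpa using h2
  refine ⟨ρ, g1 ^ k * h.map ι, ?_, ?_, ?_, hne _ hcg⟩
  · rintro rfl
    apply hgX
    have h0 : g.eval 0 = 0 := by
      have : ι (g.eval 0) = 0 := by
        rw [← eval₂_at_apply, map_zero]; exact hρ
      simpa [hι] using this
    have hX : X ∣ g := by rw [X_dvd_iff, coeff_zero_eq_eval_zero]; exact h0
    have := (irreducible_X (R := L)).associated_of_dvd hg hX
    exact (eq_of_monic_of_associated monic_X hgm this).symm
  · rw [eval_mul, eval_pow]
    exact mul_ne_zero (pow_ne_zero _ hg1ρ) (hne _ hcgh)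
  · rw [hh, ← hι, Polynomial.map_mul, Polynomial.map_pow, hg1, mul_pow]
    ring

lemma root_data (f₁ f₂ g : L[X]) (hcop : IsCoprime f₁ f₂) (k : ℕ) (hk : 0 < k)
    (hgm : g.Monic) (hg : Irreducible g) (hgX : g ≠ X) (hgk : g ^ k ∣ f₁ * f₂)
    (hgk1 : ¬ g ^ (k + 1) ∣ f₁ * f₂) : RootData f₁ f₂ k ∨ RootData f₂ f₁ k := by
  have : g ∣ f₁ * f₂ := (dvd_pow_self g hk.ne').trans hgk
  rcases hg.prime.dvd_or_dvd this with h | h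
  · exact Or.inl (root_data_aux f₁ f₂ g hcop k hgm hg hgX hgk hgk1 h)
  · rw [mul_comm] at hgk hgk1
    exact Or.inr (root_data_aux f₂ f₁ g hcop.symm k hgm hg hgX hgk hgk1 h)

lemma root_data_P (f₁ f₂ : L[X]) (k d s : ℕ) (hk : k.Coprime d) (hs : s.Coprime d)
    (h : RootData f₁ f₂ k ∨ RootData f₂ f₁ k) :
    ∃ (k' : ℕ) (ρ : AlgebraicClosure L) (P0 : (AlgebraicClosure L)[X]), ρ ≠ 0 ∧ P0.eval ρ ≠ 0 ∧
      k'.Coprime d ∧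
      (f₁ * f₂ ^ s).map (algebraMap L (AlgebraicClosure L)) = (X - C ρ) ^ k' * P0 := by
  rcases h with ⟨ρ, P1, h1, h2, h3, h4⟩ | ⟨ρ, P1, h1, h2, h3, h4⟩
  · refine ⟨k, ρ, P1 * (f₂.map (algebraMap L (AlgebraicClosure L))) ^ s, h1, ?_, hk, ?_⟩
    · rw [eval_mul, eval_pow]; exact mul_ne_zero h2 (pow_ne_zero _ h4)
    · rw [Polynomial.map_mul, Polynomial.map_pow, h3]; ring
  · refine ⟨k * s, ρ, P1 ^ s * (f₁.map (algebraMap L (AlgebraicClosure L))), h1, ?_,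
      hk.mul_left hs, ?_⟩
    · rw [eval_mul, eval_pow]; exact mul_ne_zero (pow_ne_zero _ h2) h4
    · rw [Polynomial.map_mul, Polynomial.map_pow, h3, mul_pow, ← pow_mul]; ring

lemma char_bound (θ : MulChar L ℂ) (hθ : Faithful θ)
    (d E D0 μ k : ℕ) (hdE : Fintype.card L = d * E + 1) (P : L[X])
    (P0 : (AlgebraicClosure L)[X]) (ρ : AlgebraicClosure L) (hρ : ρ ≠ 0)
    (hP : P.map (algebraMap L (AlgebraicClosure L)) = (X - C ρ) ^ k * P0)
    (hP0 : P0.eval ρ ≠ 0) (hk : k.Coprime d) (hPD : P.natDegree ≤ D0) (hμ : 1 ≤ μ)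
    (hE : (4 + d * (2 * d * D0)) * μ ^ 2 + 1 ≤ E) (T : ℝ) (hT0 : 0 ≤ T)
    (hT1 : (Fintype.card L : ℝ) + √((Fintype.card L : ℝ) * ((Fintype.card L : ℝ) ^ 2 *
        ((Fintype.card L : ℝ) * (2 * d * D0 + 2) / μ + 2 * d * D0) +
          3 * D0 * (Fintype.card L : ℝ) * (Fintype.card L : ℝ))) ≤ T ^ 2)
    (hT2 : √(2 * (Fintype.card L : ℝ)) + D0 ≤ T)
    (V : AddSubgroup L) [Fintype V] (i j : ℕ) (hid : i < d) (hjd : j < d)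
    (hij : ¬ (i = 0 ∧ j = 0)) :
    ‖∑ x : V, (θ ^ (E * i)) (x : L) * (θ ^ (E * j)) (P.eval (x : L))‖ ≤ T := by
  classical
  rcases Nat.eq_zero_or_pos j with hj | hj
  · have hi : 0 < i := by omega
    subst hj
    set χ := θ ^ (E * i) with hχ
    have hχ1 : χ ≠ 1 := faithful_pow_ne_one θ hθ d E i hdE hi hid
    have h1 := single_bound χ hχ1 V
    have h2 : ‖∑ x : V, χ (x : L)‖ ≤ √(2 * (Fintype.card L : ℝ)) := Real.le_sqrt_of_sq_le h1
    have hPne : P ≠ 0 := by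
      rintro rfl
      rw [Polynomial.map_zero] at hP
      have : (X - C ρ) ^ k * P0 ≠ 0 := by
        refine mul_ne_zero (pow_ne_zero _ (X_sub_C_ne_zero ρ)) ?_
        rintro rfl; simp at hP0
      exact this hP.symm
    have e : ∑ x : V, χ (x : L) * (θ ^ (E * 0)) (P.eval (x : L)) = ∑ x : V, χ (x : L) +
        ∑ x ∈ Finset.univ.filter (fun x : V => P.eval (x : L) = 0), (- χ (x : L)) := by
      rw [Finset.sum_filter, ← Finset.sum_add_distrib]
      refine Finset.sum_congr rfl fun x _ => ?_
      rw [mul_zero, pow_zero]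
      split_ifs with h0
      · rw [h0, MulChar.map_zero]; ring
      · rw [MulChar.one_apply (IsUnit.mk0 _ h0)]; ring
    have h3 : ‖∑ x ∈ Finset.univ.filter (fun x : V => P.eval (x : L) = 0), (- χ (x : L))‖ ≤ D0 := by
      refine (norm_sum_le _ _).trans ?_
      refine (Finset.sum_le_card_nsmul _ _ 1 fun x _ => ?_).trans ?_
      · rw [norm_neg]; exact norm_mulChar_le χ _
      · rw [nsmul_eq_mul, mul_one]
        have := count_roots_inj (Finset.univ : Finset V) (fun x => (x : L))
          Subtype.val_injective P hPne D0 hPD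
        exact_mod_cast this
    rw [e]
    refine (norm_add_le _ _).trans ?_
    linarith
  · have := mixed_bound θ hθ d E D0 μ k i j hdE P P0 ρ hρ hP hP0 hk hPD hμ hE hj hjd V
    exact abs_le_of_sq_le_sq' (this.trans hT1) hT0 |>.2

lemma count_A [DecidableEq L] (d E m μ k : ℕ) (hdE : Fintype.card L = d * E + 1) (f₁ f₂ : L[X])
    (hf₁ : f₁.natDegree ≤ m) (hf₂ : f₂.natDegree ≤ m)
    (hk : k.Coprime d) (hroot : RootData f₁ f₂ k ∨ RootData f₂ f₁ k) (hμ : 1 ≤ μ)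
    (hE : (4 + d * (2 * d * (2 * d * m))) * μ ^ 2 + 1 ≤ E) (T : ℝ) (hT0 : 0 ≤ T)
    (hT1 : (Fintype.card L : ℝ) + √((Fintype.card L : ℝ) * ((Fintype.card L : ℝ) ^ 2 *
        ((Fintype.card L : ℝ) * (2 * d * (2 * d * m : ℕ) + 2) / μ + 2 * d * (2 * d * m : ℕ)) +
          3 * (2 * d * m : ℕ) * (Fintype.card L : ℝ) * (Fintype.card L : ℝ))) ≤ T ^ 2)
    (hT2 : √(2 * (Fintype.card L : ℝ)) + (2 * d * m : ℕ) ≤ T)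
    (A B : Finset L) (hA0 : (0 : L) ∉ A) (hB0 : (0 : L) ∉ B)
    (hA : ∀ x ∈ A, ∀ u : L, u ^ E = 1 → u * x ∈ A)
    (hB : ∀ x ∈ B, ∀ u : L, u ^ E = 1 → u * x ∈ B)
    {ι : Type*} (Vg : ι → AddSubgroup L) (G : Finset ι) (N : Finset L)
    (hN : ∀ x, x ∈ N ↔ ∀ g ∈ G, x ∉ Vg g) :
    |((N.filter fun x : L => x ∈ A ∧ f₁.eval x / f₂.eval x ∈ B).card : ℝ) -
      N.card * ((A.card / ((Fintype.card L : ℝ) - 1)) * (B.card / ((Fintype.card L : ℝ) - 1)))| ≤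
        2 ^ G.card * (d ^ 2 * T + (2 * d * m + 1)) := by
  classical
  have hcard := Fintype.one_lt_card (α := L)
  have hd : 0 < d := by
    rcases Nat.eq_zero_or_pos d with h0 | h0
    · rw [hdE, h0] at hcard; omega
    · exact h0
  obtain ⟨θ, hθ⟩ := exists_faithful (L := L)
  have hs : (2 * d - 1).Coprime d := by
    have : Nat.Coprime (2 * d - 1) (2 * d - 1 + 1) := by simp
    rw [show 2 * d - 1 + 1 = 2 * d by omega] at this
    exact this.coprime_mul_left_right
  obtain ⟨k', ρ, P0, hρ, hP0, hk', hP⟩ := root_data_P f₁ f₂ k d (2 * d - 1) hk hs hroot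
  set P := f₁ * f₂ ^ (2 * d - 1) with hPdef
  have hPD : P.natDegree ≤ 2 * d * m := by
    refine natDegree_mul_le.trans ?_
    have h1 : (f₂ ^ (2 * d - 1)).natDegree ≤ (2 * d - 1) * m :=
      natDegree_pow_le.trans (Nat.mul_le_mul_left _ hf₂)
    calc f₁.natDegree + (f₂ ^ (2 * d - 1)).natDegree ≤ m + (2 * d - 1) * m := by omega
      _ = (2 * d - 1 + 1) * m := by ring
      _ = 2 * d * m := by rw [show 2 * d - 1 + 1 = 2 * d by omega]
  have hPne : P ≠ 0 := by
    intro h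
    rw [h, Polynomial.map_zero] at hP
    have : (X - C ρ) ^ k' * P0 ≠ 0 := by
      refine mul_ne_zero (pow_ne_zero _ (X_sub_C_ne_zero ρ)) ?_
      rintro rfl; simp at hP0
    exact this hP.symm
  have hZ : (Finset.univ.filter fun x : L => x = 0 ∨ P.eval x = 0).card ≤ 2 * d * m + 1 := by
    rw [Finset.filter_or]
    refine (Finset.card_union_le _ _).trans ?_
    have h1 := count_roots_inj (Finset.univ : Finset L) id Function.injective_id P hPne _ hPD
    have h2 : (Finset.univ.filter fun x : L => x = 0).card = 1 := by
      rw [Finset.filter_eq' , if_pos (Finset.mem_univ _), Finset.card_singleton]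
    simp only [id] at h1
    omega
  have hequiv : ∀ x : L, P.eval x ∈ B ↔ f₁.eval x / f₂.eval x ∈ B := by
    intro x
    by_cases h0 : f₂.eval x = 0
    · rw [hPdef, eval_mul, eval_pow, h0, zero_pow (by omega), mul_zero, div_zero]
    · set t := f₂.eval x
      have hu : (t ^ (2 * d)) ^ E = 1 := by
        have := FiniteField.pow_card_sub_one_eq_one t h0
        rw [hdE, Nat.add_sub_cancel] at this
        rw [← pow_mul, show 2 * d * E = d * E * 2 by ring, pow_mul, this, one_pow]
      have e : P.eval x = t ^ (2 * d) * (f₁.eval x / t) := by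
        rw [hPdef, eval_mul, eval_pow]
        have : t ^ (2 * d) = t ^ (2 * d - 1) * t := by
          rw [← pow_succ]; congr 1; omega
        rw [this]; field_simp; rfl
      constructor
      · intro h
        have := hB _ h ((t ^ (2 * d))⁻¹) (by rw [inv_pow, hu, inv_one])
        rwa [e, ← mul_assoc, inv_mul_cancel₀ (pow_ne_zero _ h0), one_mul] at this
      · intro h
        rw [e]; exact hB _ h _ hu
  set c : ℝ := ((A.card / ((Fintype.card L : ℝ) - 1)) * (B.card / ((Fintype.card L : ℝ) - 1)))
    with hc
  have hall : ∀ V : AddSubgroup L,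
      |((Finset.univ.filter fun x : L => x ∈ V ∧ (x ∈ A ∧ f₁.eval x / f₂.eval x ∈ B)).card : ℝ) -
      (Finset.univ.filter fun x : L => x ∈ V).card * c| ≤ d ^ 2 * T + (2 * d * m + 1) := by
    intro V
    have h1 := equidist θ hθ d E hdE P (2 * d * m + 1) hZ A B hA0 hB0 hA hB V T hT0
      (fun i j hi hj hij => char_bound θ hθ d E (2 * d * m) μ k' hdE P P0 ρ hρ hP hP0 hk' hPD hμ hE
        T hT0 hT1 hT2 V i j hi hj hij)
    have e1 : (Finset.univ.filter fun x : L => x ∈ V ∧ (x ∈ A ∧ f₁.eval x / f₂.eval x ∈ B)).card =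
        (Finset.univ.filter fun x : V => (x : L) ∈ A ∧ P.eval (x : L) ∈ B).card := by
      rw [← Finset.card_map ⟨((↑) : V → L), Subtype.val_injective⟩]
      congr 1
      ext x
      simp only [Finset.mem_filter, Finset.mem_univ, true_and, Finset.mem_map, Function.Embedding.coeFn_mk, Subtype.exists, exists_and_right, exists_eq_right, hequiv]
      constructor
      · rintro ⟨h1, h2, h3⟩
        exact ⟨⟨h1, h2⟩, h3⟩
      · rintro ⟨⟨h1, h2⟩, h3⟩
        exact ⟨h1, h2, h3⟩
    have e2 : (Finset.univ.filter fun x : L => x ∈ V).card = Fintype.card V := by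
      rw [Fintype.card_subtype]
    rw [e1, e2]
    push_cast at h1
    exact h1
  have key := incl_excl Vg (fun x => x ∈ A ∧ f₁.eval x / f₂.eval x ∈ B) c
    (d ^ 2 * T + (2 * d * m + 1)) (by
      intro V
      have := hall V
      convert this using 5
      ext x; simp only [Finset.mem_filter]) G ⊤
  have e1 : N = Finset.univ.filter fun x : L => x ∈ (⊤ : AddSubgroup L) ∧ ∀ g ∈ G, x ∉ Vg g := by
    ext x; simp [hN]
  have e2 : (N.filter fun x : L => x ∈ A ∧ f₁.eval x / f₂.eval x ∈ B) = Finset.univ.filter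
      fun x : L => (x ∈ (⊤ : AddSubgroup L) ∧ ∀ g ∈ G, x ∉ Vg g) ∧
        (x ∈ A ∧ f₁.eval x / f₂.eval x ∈ B) := by
    ext x; simp [hN]
  rw [e2, e1]
  convert key using 5
  ext x; simp only [Finset.mem_filter]

end PolyData


section Sieve

variable {L : Type} [Field L] [Fintype L] [DecidableEq L]

open Classical in
/-- the nonzero elements that are not `p`-th powers for the primes `p ∣ e` -/
noncomputable def FreeSet (L : Type) [Field L] [Fintype L] (e : ℕ) : Finset L :=
  Finset.univ.filter fun y : L => y ≠ 0 ∧ ∀ p : ℕ, p.Prime → p ∣ e →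
    y ^ ((Fintype.card L - 1) / p) ≠ 1

lemma mem_FreeSet (e : ℕ) (y : L) : y ∈ FreeSet L e ↔ y ≠ 0 ∧ ∀ p : ℕ, p.Prime → p ∣ e →
    y ^ ((Fintype.card L - 1) / p) ≠ 1 := by
  simp [FreeSet]

lemma card_sub_pos : 0 < Fintype.card L - 1 := by
  have := Fintype.one_lt_card (α := L); omega

lemma root_pow (d E p : ℕ) (hdE : Fintype.card L = d * E + 1) (hp : p ∣ d) (u : L)
    (hu : u ^ E = 1) : u ^ ((Fintype.card L - 1) / p) = 1 := by
  have h0 := card_sub_pos (L := L)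
  rw [hdE, Nat.add_sub_cancel] at *
  obtain ⟨c, rfl⟩ := hp
  have hp0 : 0 < p := by
    rcases Nat.eq_zero_or_pos p with h | h
    · simp [h] at h0
    · exact h
  rw [mul_assoc, Nat.mul_div_cancel_left _ hp0, mul_comm, pow_mul, hu, one_pow]

lemma free_inv (d E e : ℕ) (hdE : Fintype.card L = d * E + 1) (he : e ∣ d) :
    ∀ x ∈ FreeSet L e, ∀ u : L, u ^ E = 1 → u * x ∈ FreeSet L e := by
  intro x hx u hu
  rw [mem_FreeSet] at hx ⊢
  have h0 := card_sub_pos (L := L)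
  have hE : E ≠ 0 := by
    rintro rfl
    rw [hdE] at h0; simp at h0
  refine ⟨mul_ne_zero ?_ hx.1, fun p hp hpe => ?_⟩
  · rintro rfl
    rw [zero_pow hE] at hu; exact zero_ne_one hu
  · rw [mul_pow, root_pow d E p hdE (hpe.trans he) u hu, one_mul]
    exact hx.2 p hp hpe

lemma free_pow_inv (d E e ℓ : ℕ) (hdE : Fintype.card L = d * E + 1) (he : e ∣ d) (hℓ : ℓ ∣ d) :
    ∀ x ∈ (FreeSet L e).filter (fun y => y ^ ((Fintype.card L - 1) / ℓ) = 1), ∀ u : L, u ^ E = 1 →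
      u * x ∈ (FreeSet L e).filter (fun y => y ^ ((Fintype.card L - 1) / ℓ) = 1) := by
  intro x hx u hu
  rw [Finset.mem_filter] at hx ⊢
  refine ⟨free_inv d E e hdE he x hx.1 u hu, ?_⟩
  rw [mul_pow, root_pow d E ℓ hdE hℓ u hu, one_mul, hx.2]

lemma free_card_ge (e E : ℕ) (hdE : Fintype.card L = e * E + 1) : E ≤ (FreeSet L e).card := by
  classical
  obtain ⟨g, hg0, hg⟩ := exists_gen (L := L)
  conv_lhs => rw [← card_roots_unity e E hdE]
  refine Finset.card_le_card_of_injOn (fun u => u * g) ?_ ?_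
  · intro u hu
    have hu1 : u ^ E = 1 := by simpa using hu
    refine free_inv e E e hdE dvd_rfl g ?_ u hu1
    rw [mem_FreeSet]
    refine ⟨hg0, fun p hp hpe h => ?_⟩
    have h1 := orderOf_dvd_of_pow_eq_one h
    rw [hg] at h1
    have h0 := card_sub_pos (L := L)
    have hpd : p ∣ Fintype.card L - 1 := by
      rw [hdE, Nat.add_sub_cancel]; exact hpe.mul_right _
    have h2 : 0 < (Fintype.card L - 1) / p := Nat.div_pos (Nat.le_of_dvd h0 hpd) hp.pos
    have h3 := Nat.le_of_dvd h2 h1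
    have h4 := Nat.div_lt_self h0 hp.one_lt
    omega
  · intro u _ v _ huv
    exact mul_right_cancel₀ hg0 huv

lemma free_pow_card (e ℓ : ℕ) (hℓ : ℓ.Prime) (hℓe : ¬ ℓ ∣ e)
    (hℓQ : ℓ ∣ Fintype.card L - 1) (he : e ∣ Fintype.card L - 1) :
    ℓ * ((FreeSet L e).filter (fun y => y ^ ((Fintype.card L - 1) / ℓ) = 1)).card ≤
      (FreeSet L e).card := by
  obtain ⟨g, hg0, hg⟩ := exists_gen (L := L)
  have h0 := card_sub_pos (L := L)
  set M := Fintype.card L - 1 with hM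
  have hr : ∀ c, ℓ * c = (Finset.range ℓ).card * c := fun c => by rw [Finset.card_range]
  rw [hr, ← Finset.card_product]
  refine Finset.card_le_card_of_injOn (fun p => p.2 * g ^ (e * p.1)) ?_ ?_
  · rintro ⟨j, z⟩ hz
    simp only [Finset.coe_product, Set.mem_prod, Finset.mem_coe, Finset.mem_filter] at hz
    simp only [Finset.mem_coe]
    obtain ⟨_, hz1, _⟩ := hz
    rw [mem_FreeSet] at hz1 ⊢
    refine ⟨mul_ne_zero hz1.1 (pow_ne_zero _ hg0), fun p hp hpe => ?_⟩
    have : (g ^ (e * j)) ^ (M / p) = 1 := by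
      rw [← pow_mul]
      apply orderOf_dvd_iff_pow_eq_one.mp
      rw [hg]
      obtain ⟨c, rfl⟩ := hpe
      have : p ∣ M := (dvd_mul_right p c).trans he
      refine ⟨c * j, ?_⟩
      conv_rhs => rw [← Nat.mul_div_cancel' this]
      ring
    rw [← hM, mul_pow, this, mul_one]
    exact hz1.2 p hp hpe
  · have key : ∀ i j : ℕ, i < ℓ → j < ℓ → i ≤ j → ∀ z z' : L, z ≠ 0 →
        z ^ (M / ℓ) = 1 → z' ^ (M / ℓ) = 1 → z * g ^ (e * i) = z' * g ^ (e * j) → i = j := by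
      intro i j hi hj hij z z' hz0 hz hz' heq
      have h1 := congrArg (· ^ (M / ℓ)) heq
      simp only [mul_pow, hz, hz', one_mul] at h1
      have h2 : g ^ (e * i * (M / ℓ)) = g ^ (e * j * (M / ℓ)) := by
        rw [pow_mul, pow_mul _ (e * j)]; exact h1
      have h3 : e * i * (M / ℓ) ≡ e * j * (M / ℓ) [MOD M] := by
        have h2' : (Units.mk0 g hg0) ^ (e * i * (M / ℓ)) = (Units.mk0 g hg0) ^ (e * j * (M / ℓ)) := by
          ext; push_cast; exact h2
        rw [pow_eq_pow_iff_modEq, ← orderOf_units, Units.val_mk0, hg] at h2'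
        exact h2'
      have hle : e * i * (M / ℓ) ≤ e * j * (M / ℓ) := by gcongr
      have h4 := (Nat.modEq_iff_dvd' hle).mp h3
      rw [← Nat.sub_mul, ← Nat.mul_sub] at h4
      conv at h4 => lhs; rw [← Nat.mul_div_cancel' hℓQ]
      have h5 : 0 < M / ℓ := Nat.div_pos (Nat.le_of_dvd h0 hℓQ) hℓ.pos
      have h6 := Nat.dvd_of_mul_dvd_mul_right h5 h4
      have h7 := (hℓ.dvd_mul.mp h6).resolve_left hℓe
      have := Nat.eq_zero_of_dvd_of_lt h7 (by omega)
      omega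
    rintro ⟨i, z⟩ hz ⟨j, z'⟩ hz' heq
    simp only [Finset.coe_product, Set.mem_prod, Finset.mem_coe, Finset.mem_filter,
      Finset.mem_range] at hz hz'
    simp only at heq
    have hz0 := ((mem_FreeSet e z).mp hz.2.1).1
    have hz0' := ((mem_FreeSet e z').mp hz'.2.1).1
    have hij : i = j := by
      rcases le_total i j with h | h
      · exact key i j hz.1 hz'.1 h z z' hz0 hz.2.2 hz'.2.2 heq
      · exact (key j i hz'.1 hz.1 h z' z hz0' hz'.2.2 hz.2.2 heq.symm).symm
    subst hij
    have := mul_right_cancel₀ (pow_ne_zero _ hg0) heq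
    rw [this]

lemma pow_card (ℓ : ℕ) (hℓQ : ℓ ∣ Fintype.card L - 1) :
    (Finset.univ.filter (fun y : L => y ^ ((Fintype.card L - 1) / ℓ) = 1)).card =
      (Fintype.card L - 1) / ℓ := by
  refine card_roots_unity ℓ _ ?_
  rw [Nat.mul_div_cancel' hℓQ]
  have := Fintype.one_lt_card (α := L); omega

lemma fibre_card (f₁ f₂ : L[X]) (m k ℓ : ℕ) (hf₁ : f₁.natDegree ≤ m) (hf₂ : f₂.natDegree ≤ m)
    (hk : 0 < k) (hroot : RootData f₁ f₂ k ∨ RootData f₂ f₁ k) (hℓ : ℓ.Prime)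
    (hℓQ : ℓ ∣ Fintype.card L - 1) :
    (Finset.univ.filter (fun x : L =>
      (f₁.eval x / f₂.eval x) ^ ((Fintype.card L - 1) / ℓ) = 1)).card ≤
      m * ((Fintype.card L - 1) / ℓ) := by
  have h5 : 0 < (Fintype.card L - 1) / ℓ :=
    Nat.div_pos (Nat.le_of_dvd card_sub_pos hℓQ) hℓ.pos
  conv_rhs => rw [← pow_card ℓ hℓQ]
  refine Finset.card_le_mul_card_image_of_maps_to (f := fun x => f₁.eval x / f₂.eval x)
    (t := Finset.univ.filter (fun y : L => y ^ ((Fintype.card L - 1) / ℓ) = 1)) ?_ m ?_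
  · intro x hx
    simpa using hx
  · intro v hv
    have hv1 : v ^ ((Fintype.card L - 1) / ℓ) = 1 := by simpa using hv
    have hv0 : v ≠ 0 := by
      rintro rfl
      rw [zero_pow h5.ne'] at hv1; exact zero_ne_one hv1
    set ι := algebraMap L (AlgebraicClosure L) with hι
    have hne : f₁ - C v * f₂ ≠ 0 := by
      intro h
      have hm : f₁.map ι = C (ι v) * f₂.map ι := by
        have := congrArg (Polynomial.map ι) (sub_eq_zero.mp h)
        simpa using this
      rcases hroot with ⟨ρ, P1, h1, h2, h3, h4⟩ | ⟨ρ, P1, h1, h2, h3, h4⟩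
      · have := congrArg (eval ρ) hm
        rw [h3, eval_mul, eval_pow, eval_sub, eval_X, eval_C, sub_self, zero_pow hk.ne', zero_mul,
          eval_mul, eval_C] at this
        exact (mul_ne_zero (by simpa [hι] using hv0) h4) this.symm
      · have := congrArg (eval ρ) hm
        rw [h3, eval_mul, eval_C, eval_mul, eval_pow, eval_sub, eval_X, eval_C, sub_self,
          zero_pow hk.ne', zero_mul, mul_zero] at this
        exact h4 this
    have hdeg : (f₁ - C v * f₂).natDegree ≤ m := by
      refine (natDegree_sub_le _ _).trans (max_le hf₁ ?_)
      exact (natDegree_C_mul_le _ _).trans hf₂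
    have := count_roots_inj (Finset.univ : Finset L) id Function.injective_id _ hne m hdeg
    refine le_trans (Finset.card_le_card ?_) this
    intro x hx
    simp only [Finset.mem_filter, Finset.mem_univ, true_and, id] at hx ⊢
    have hf : f₂.eval x ≠ 0 := by
      intro h
      rw [h, div_zero] at hx
      exact hv0 hx.2.symm
    rw [eval_sub, eval_mul, eval_C, ← hx.2]
    field_simp
    ring

lemma primitive_of_free (e : ℕ) (y : L) (hy : y ∈ FreeSet L e)
    (h : ∀ ℓ : ℕ, ℓ.Prime → ℓ ∣ Fintype.card L - 1 → ¬ ℓ ∣ e →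
      y ^ ((Fintype.card L - 1) / ℓ) ≠ 1) : orderOf y = Fintype.card L - 1 := by
  rw [mem_FreeSet] at hy
  refine orderOf_eq_of_pow_and_pow_div_prime card_sub_pos
    (FiniteField.pow_card_sub_one_eq_one y hy.1) fun p hp hpQ => ?_
  by_cases hpe : p ∣ e
  · exact hy.2 p hp hpe
  · exact h p hp hpQ hpe

/-- equidistribution at level `E` with error `R` -/
def EquiAt (N : Finset L) (f₁ f₂ : L[X]) (E : ℕ) (R : ℝ) : Prop :=
  ∀ A B : Finset L, (0 : L) ∉ A → (0 : L) ∉ B →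
    (∀ x ∈ A, ∀ u : L, u ^ E = 1 → u * x ∈ A) →
    (∀ x ∈ B, ∀ u : L, u ^ E = 1 → u * x ∈ B) →
    |((N.filter fun x : L => x ∈ A ∧ f₁.eval x / f₂.eval x ∈ B).card : ℝ) -
      N.card * ((A.card / ((Fintype.card L : ℝ) - 1)) * (B.card / ((Fintype.card L : ℝ) - 1)))| ≤ R

lemma sieve (N : Finset L) (f₁ f₂ : L[X]) (m k e : ℕ) (hf₁ : f₁.natDegree ≤ m)
    (hf₂ : f₂.natDegree ≤ m)
    (hk : 0 < k) (hroot : RootData f₁ f₂ k ∨ RootData f₂ f₁ k) (he : e ∣ Fintype.card L - 1)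
    (Pb : Finset ℕ) (hPb : ∀ ℓ, ℓ ∈ Pb ↔ ℓ.Prime ∧ ℓ ∣ Fintype.card L - 1 ∧ ¬ ℓ ∣ e)
    (hsum : ∑ ℓ ∈ Pb, (1 / (ℓ : ℝ)) ≤ 1 / 4) (R : ℝ) (Y : ℕ) (hY : 0 < Y)
    (hR : ∀ d E, Fintype.card L = d * E + 1 → (d = e ∨ ∃ ℓ ∈ Pb, ℓ ≤ Y ∧ d = e * ℓ) →
      EquiAt N f₁ f₂ E R)
    (hbig : (2 * Pb.card + 1) * R + Pb.card * ((m + 1) * (Fintype.card L : ℝ) / Y) <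
      N.card * (1 / (e : ℝ)) ^ 2 / 2) :
    ∃ x ∈ N, orderOf x = Fintype.card L - 1 ∧
      orderOf (f₁.eval x / f₂.eval x) = Fintype.card L - 1 := by
  have h0 := card_sub_pos (L := L)
  have hQc : (Fintype.card L - 1) + 1 = Fintype.card L := by omega
  have he0 : 0 < e := Nat.pos_of_dvd_of_pos he h0
  set M := Fintype.card L - 1 with hM
  have hMR : (Fintype.card L : ℝ) - 1 = M := by rw [← hQc]; push_cast; ring
  have hMR0 : (0 : ℝ) < M := by exact_mod_cast h0
  set F := FreeSet L e with hF
  set t : ℝ := F.card / ((Fintype.card L : ℝ) - 1) with ht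
  have ht0 : 0 ≤ t := by rw [ht, hMR]; positivity
  have hte : 1 / (e : ℝ) ≤ t := by
    obtain ⟨E, hE⟩ := he
    have h1 := free_card_ge (L := L) e E (by rw [← hQc, hE])
    have he0' : (0 : ℝ) < e := by exact_mod_cast he0
    rw [ht, hMR, div_le_div_iff₀ he0' hMR0, one_mul, hE]
    push_cast
    rw [mul_comm]
    gcongr
  have hF0 : (0 : L) ∉ F := fun h => ((mem_FreeSet e _).mp h).1 rfl
  set Fl : ℕ → Finset L := fun ℓ => F.filter (fun y => y ^ (M / ℓ) = 1) with hFl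
  have hFl0 : ∀ ℓ, (0 : L) ∉ Fl ℓ := fun ℓ h => hF0 (Finset.mem_filter.mp h).1
  have hFlc : ∀ ℓ ∈ Pb, (Fl ℓ).card / ((Fintype.card L : ℝ) - 1) ≤ t * (1 / ℓ) := by
    intro ℓ hℓ
    obtain ⟨h1, h2, h3⟩ := (hPb ℓ).mp hℓ
    have h4 := free_pow_card (L := L) e ℓ h1 h3 h2 he
    have h5 : (ℓ : ℝ) * (Fl ℓ).card ≤ F.card := by exact_mod_cast h4
    have hl : (0 : ℝ) < ℓ := by exact_mod_cast h1.pos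
    rw [ht, hMR, div_mul_div_comm, mul_one, div_le_div_iff₀ hMR0 (by positivity)]
    calc ((Fl ℓ).card : ℝ) * (M * ℓ) = (ℓ * (Fl ℓ).card) * M := by ring
      _ ≤ F.card * M := by gcongr
  set f : L → L := fun x => f₁.eval x / f₂.eval x with hf
  set S := N.filter fun x => x ∈ F ∧ f x ∈ F with hS
  by_contra hcon
  push Not at hcon
  -- upper bound
  have hcover : S ⊆ Pb.biUnion fun ℓ => (N.filter fun x => x ∈ Fl ℓ ∧ f x ∈ F) ∪
      (N.filter fun x => x ∈ F ∧ f x ∈ Fl ℓ) := by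
    intro x hx
    obtain ⟨hxN, hxF, hfF⟩ := Finset.mem_filter.mp hx
    by_contra hno
    simp only [Finset.mem_biUnion, not_exists, not_and, Finset.mem_union, Finset.mem_filter,
      not_or] at hno
    refine hcon x hxN ?_ ?_
    · refine primitive_of_free e x hxF fun ℓ h1 h2 h3 h4 => ?_
      exact (hno ℓ ((hPb ℓ).mpr ⟨h1, h2, h3⟩)).1 hxN (Finset.mem_filter.mpr ⟨hxF, h4⟩) hfF
    · refine primitive_of_free e _ hfF fun ℓ h1 h2 h3 h4 => ?_
      exact (hno ℓ ((hPb ℓ).mpr ⟨h1, h2, h3⟩)).2 hxN hxF (Finset.mem_filter.mpr ⟨hfF, h4⟩)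
  have hNt : 0 ≤ N.card * t ^ 2 := by positivity
  have hR0 : 0 ≤ R := by
    obtain ⟨E, hE⟩ := he
    have := hR e E (by rw [← hQc, hE]) (Or.inl rfl) ∅ ∅ (by simp) (by simp) (by simp) (by simp)
    exact (abs_nonneg _).trans this
  have hup : ∀ ℓ ∈ Pb, (((N.filter fun x => x ∈ Fl ℓ ∧ f x ∈ F) ∪
      (N.filter fun x => x ∈ F ∧ f x ∈ Fl ℓ)).card : ℝ) ≤
      N.card * t ^ 2 * (2 * (1 / (ℓ : ℝ))) + (2 * R + (m + 1) * (Fintype.card L : ℝ) / Y) := by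
    intro ℓ hℓ
    obtain ⟨h1, h2, h3⟩ := (hPb ℓ).mp hℓ
    have hcu : (((N.filter fun x => x ∈ Fl ℓ ∧ f x ∈ F) ∪
      (N.filter fun x => x ∈ F ∧ f x ∈ Fl ℓ)).card : ℝ) ≤
      ((N.filter fun x => x ∈ Fl ℓ ∧ f x ∈ F).card : ℝ) +
      ((N.filter fun x => x ∈ F ∧ f x ∈ Fl ℓ).card : ℝ) := by
      exact_mod_cast Finset.card_union_le _ _
    refine hcu.trans ?_
    have hl : (0 : ℝ) < ℓ := by exact_mod_cast h1.pos
    have hYR : (0 : ℝ) < Y := by exact_mod_cast hY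
    by_cases hlY : ℓ ≤ Y
    · have hcop : Nat.Coprime e ℓ := ((Nat.Prime.coprime_iff_not_dvd h1).mpr h3).symm
      obtain ⟨E, hE⟩ := hcop.mul_dvd_of_dvd_of_dvd he h2
      have hdE : Fintype.card L = e * ℓ * E + 1 := by rw [← hQc, hE]
      have heq := hR (e * ℓ) E hdE (Or.inr ⟨ℓ, hℓ, hlY, rfl⟩)
      have i1 := free_inv (e * ℓ) E e hdE (dvd_mul_right _ _)
      have i2 := free_pow_inv (e * ℓ) E e ℓ hdE (dvd_mul_right _ _) (dvd_mul_left _ _)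
      have b1 := (abs_le.mp (heq (Fl ℓ) F (hFl0 ℓ) hF0 i2 i1)).2
      have b2 := (abs_le.mp (heq F (Fl ℓ) hF0 (hFl0 ℓ) i1 i2)).2
      have c1 : (N.card : ℝ) * ((Fl ℓ).card / ((Fintype.card L : ℝ) - 1) * t) ≤
          N.card * (t * (1 / ℓ) * t) := by
        gcongr
        exact hFlc ℓ hℓ
      have c2 : (N.card : ℝ) * (t * ((Fl ℓ).card / ((Fintype.card L : ℝ) - 1))) ≤
          N.card * (t * (t * (1 / ℓ))) := by
        gcongr
        exact hFlc ℓ hℓ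
      have c3 : (0 : ℝ) ≤ (m + 1) * (Fintype.card L : ℝ) / Y := by positivity
      have e1 : N.card * t ^ 2 * (2 * (1 / (ℓ : ℝ))) =
        N.card * (t * (1 / ℓ) * t) + N.card * (t * (t * (1 / ℓ))) := by ring
      linarith
    · push Not at hlY
      have hdiv : ((M / ℓ : ℕ) : ℝ) ≤ (Fintype.card L : ℝ) / Y := by
        refine Nat.cast_div_le.trans ?_
        have : (M : ℝ) ≤ Fintype.card L := by exact_mod_cast (by omega : M ≤ Fintype.card L)
        have h6 : (Y : ℝ) ≤ ℓ := by exact_mod_cast hlY.le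
        gcongr
      have b1 : ((N.filter fun x => x ∈ Fl ℓ ∧ f x ∈ F).card : ℝ) ≤ (Fintype.card L : ℝ) / Y := by
        refine le_trans ?_ hdiv
        have := pow_card (L := L) ℓ h2
        rw [← hM] at this
        rw [← this]
        have hsub : (N.filter fun x => x ∈ Fl ℓ ∧ f x ∈ F) ⊆
            Finset.univ.filter (fun y : L => y ^ (M / ℓ) = 1) := by
          intro x hx
          simp only [Finset.mem_filter, hFl] at hx
          simp [hx.2.1.2]
        exact_mod_cast Finset.card_le_card hsub
      have b2 : ((N.filter fun x => x ∈ F ∧ f x ∈ Fl ℓ).card : ℝ) ≤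
          m * ((Fintype.card L : ℝ) / Y) := by
        have h7 : ((N.filter fun x => x ∈ F ∧ f x ∈ Fl ℓ).card : ℝ) ≤ m * ((M / ℓ : ℕ) : ℝ) := by
          have := fibre_card f₁ f₂ m k ℓ hf₁ hf₂ hk hroot h1 h2
          have hsub : (N.filter fun x => x ∈ F ∧ f x ∈ Fl ℓ) ⊆ Finset.univ.filter (fun x : L =>
              (f₁.eval x / f₂.eval x) ^ ((Fintype.card L - 1) / ℓ) = 1) := by
            intro x hx
            simp only [Finset.mem_filter, hFl] at hx
            simp only [Finset.mem_filter, Finset.mem_univ, true_and]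
            exact hx.2.2.2
          exact_mod_cast (Finset.card_le_card hsub).trans this
        refine h7.trans ?_
        gcongr
      have c3 : 0 ≤ N.card * t ^ 2 * (2 * (1 / (ℓ : ℝ))) := by positivity
      have e1 : (m + 1) * (Fintype.card L : ℝ) / Y =
        (Fintype.card L : ℝ) / Y + m * ((Fintype.card L : ℝ) / Y) := by ring
      linarith
  have hlow : N.card * t ^ 2 - R ≤ S.card := by
    obtain ⟨E, hE⟩ := he
    have hdE : Fintype.card L = e * E + 1 := by rw [← hQc, hE]
    have i1 := free_inv e E e hdE dvd_rfl
    have b1 := (abs_le.mp (hR e E hdE (Or.inl rfl) F F hF0 hF0 i1 i1)).1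
    have e1 : N.card * t ^ 2 = N.card * (t * t) := by ring
    rw [e1]
    linarith
  have hSle : (S.card : ℝ) ≤ N.card * t ^ 2 * (2 * (1 / 4)) +
      Pb.card * (2 * R + (m + 1) * (Fintype.card L : ℝ) / Y) := by
    calc (S.card : ℝ) ≤ ((Pb.biUnion fun ℓ => (N.filter fun x => x ∈ Fl ℓ ∧ f x ∈ F) ∪
          (N.filter fun x => x ∈ F ∧ f x ∈ Fl ℓ)).card : ℝ) := by
          exact_mod_cast Finset.card_le_card hcover
      _ ≤ ∑ ℓ ∈ Pb, (((N.filter fun x => x ∈ Fl ℓ ∧ f x ∈ F) ∪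
            (N.filter fun x => x ∈ F ∧ f x ∈ Fl ℓ)).card : ℝ) := by
          exact_mod_cast Finset.card_biUnion_le
      _ ≤ ∑ ℓ ∈ Pb, (N.card * t ^ 2 * (2 * (1 / (ℓ : ℝ))) +
            (2 * R + (m + 1) * (Fintype.card L : ℝ) / Y)) := Finset.sum_le_sum hup
      _ = N.card * t ^ 2 * (2 * ∑ ℓ ∈ Pb, (1 / (ℓ : ℝ))) +
            Pb.card * (2 * R + (m + 1) * (Fintype.card L : ℝ) / Y) := by
          rw [Finset.sum_add_distrib, ← Finset.mul_sum, ← Finset.mul_sum, Finset.sum_const,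
            nsmul_eq_mul]
      _ ≤ _ := by gcongr
  have hfin : N.card * (1 / (e : ℝ)) ^ 2 / 2 ≤ N.card * t ^ 2 / 2 := by gcongr
  have : (Pb.card : ℝ) * (2 * R + (m + 1) * (Fintype.card L : ℝ) / Y) + R =
    (2 * Pb.card + 1) * R + Pb.card * ((m + 1) * (Fintype.card L : ℝ) / Y) := by ring
  linarith

end Sieve


section NormalElems

variable {K L : Type} [Field K] [Field L] [Fintype K] [Fintype L] [Algebra K L]

open Classical in
/-- monic irreducible factors of `X^n - 1` -/
noncomputable def facSet (K : Type) [Field K] (n : ℕ) : Finset K[X] :=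
  (UniqueFactorizationMonoid.normalizedFactors (X ^ n - 1 : K[X])).toFinset

lemma xn_ne (K : Type) [Field K] {n : ℕ} (hn : 0 < n) : (X ^ n - 1 : K[X]) ≠ 0 := by
  have := X_pow_sub_C_ne_zero hn (1 : K)
  simpa using this

lemma mem_facSet {n : ℕ} (hn : 0 < n) (g : K[X]) :
    g ∈ facSet K n ↔ g.Monic ∧ Irreducible g ∧ g ∣ X ^ n - 1 := by
  classical
  rw [facSet, Multiset.mem_toFinset]
  constructor
  · intro h
    exact ⟨by
      have h0 := UniqueFactorizationMonoid.irreducible_of_normalized_factor g h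
      have := UniqueFactorizationMonoid.normalize_normalized_factor g h
      rw [← this]; exact Polynomial.monic_normalize h0.ne_zero,
      UniqueFactorizationMonoid.irreducible_of_normalized_factor g h,
      UniqueFactorizationMonoid.dvd_of_mem_normalizedFactors h⟩
  · rintro ⟨h1, h2, h3⟩
    obtain ⟨p, hp, hgp⟩ := UniqueFactorizationMonoid.exists_mem_normalizedFactors_of_dvd
      (xn_ne K hn) h2 h3
    have hpm : p.Monic := by
      have h0 := UniqueFactorizationMonoid.irreducible_of_normalized_factor p hp
      have := UniqueFactorizationMonoid.normalize_normalized_factor p hp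
      rw [← this]; exact Polynomial.monic_normalize h0.ne_zero
    rwa [eq_of_monic_of_associated h1 hpm hgp]

/-- Frobenius as a linear map -/
noncomputable abbrev frobL (K L : Type) [Field K] [Field L] [Fintype K] [Fintype L] [Algebra K L] :
    L →ₗ[K] L := (FiniteField.frobeniusAlgHom K L).toLinearMap

/-- kernel subgroup -/
noncomputable def kerG (K L : Type) [Field K] [Field L] [Fintype K] [Fintype L] [Algebra K L]
    (n : ℕ) (g : K[X]) : AddSubgroup L :=
  (LinearMap.ker (aeval (frobL K L) ((X ^ n - 1) / g))).toAddSubgroup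

lemma mem_kerG {n : ℕ} (g c : K[X]) (hg : g ≠ 0) (hc : X ^ n - 1 = g * c) (x : L) :
    x ∈ kerG K L n g ↔ aeval (frobL K L) c x = 0 := by
  rw [kerG, hc, mul_div_cancel_left₀ _ hg]
  simp

lemma frob_pow_apply (i : ℕ) (x : L) : (frobL K L ^ i) x = x ^ Fintype.card K ^ i := by
  induction i with
  | zero => simp
  | succ i ih =>
    rw [pow_succ', Module.End.mul_apply, ih]
    simp [pow_succ, pow_mul]

lemma minpoly_dvd_iff {n : ℕ} (hn : n = Module.finrank K L) (h : K[X]) :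
    aeval (frobL K L) h = 0 ↔ (X ^ n - 1) ∣ h := by
  rw [hn, ← FiniteField.minpoly_frobeniusAlgHom K L, minpoly.dvd_iff]

lemma normal_lin {n : ℕ} (hn : n = Module.finrank K L) (α : L)
    (hα : ∀ g ∈ facSet K n, α ∉ kerG K L n g) :
    LinearIndependent K (fun i : Fin n => α ^ Fintype.card K ^ (i : ℕ)) := by
  have hn0 : 0 < n := hn ▸ Module.finrank_pos
  rw [Fintype.linearIndependent_iff]
  intro c hc
  by_contra hne
  set h : K[X] := ∑ i : Fin n, C (c i) * X ^ (i : ℕ) with hh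
  have hcoeff : ∀ i : Fin n, h.coeff i = c i := by
    intro i
    rw [hh, finsetSum_coeff]
    simp only [coeff_C_mul_X_pow]
    rw [Finset.sum_eq_single i]
    · simp
    · intro j _ hj
      rw [if_neg]
      intro h; exact hj (Fin.ext h.symm)
    · simp
  have hh0 : h ≠ 0 := by
    intro h0
    apply hne
    intro i
    rw [← hcoeff i, h0, coeff_zero]
  have hdeg : h.degree < n := by
    rw [degree_lt_iff_coeff_zero]
    intro j hj
    rw [hh, finsetSum_coeff]
    simp only [coeff_C_mul_X_pow]
    refine Finset.sum_eq_zero fun i _ => if_neg ?_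
    have := i.2
    omega
  have hker : aeval (frobL K L) h α = 0 := by
    rw [hh, map_sum, LinearMap.sum_apply]
    rw [← hc]
    refine Finset.sum_congr rfl fun i _ => ?_
    rw [map_mul, aeval_C, map_pow, aeval_X, Module.End.mul_apply, frob_pow_apply]
    simp
  -- gcd
  classical
  have hd1 : EuclideanDomain.gcd h (X ^ n - 1) ∣ X ^ n - 1 := EuclideanDomain.gcd_dvd_right _ _
  have hd2 : EuclideanDomain.gcd h (X ^ n - 1) ∣ h := EuclideanDomain.gcd_dvd_left _ _
  have hd3 := EuclideanDomain.gcd_eq_gcd_ab h (X ^ n - 1)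
  set d := EuclideanDomain.gcd h (X ^ n - 1) with hd
  have hdα : aeval (frobL K L) d α = 0 := by
    rw [hd3, map_add, map_mul, map_mul, (minpoly_dvd_iff hn _).2 dvd_rfl, ← map_mul,
      mul_comm h, map_mul]
    simp [Module.End.mul_apply, hker]
  obtain ⟨b, hb⟩ := hd1
  have hb0 : b ≠ 0 := by
    rintro rfl
    exact xn_ne K hn0 (by rw [hb, mul_zero])
  have hbu : ¬ IsUnit b := by
    intro hu
    have h1 : X ^ n - 1 ∣ h := by
      rw [hb]
      exact (hu.mul_right_dvd).2 hd2
    have h2 := degree_le_of_dvd h1 hh0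
    have h3 : (X ^ n - 1 : K[X]).degree = n := by
      have := degree_X_pow_sub_C hn0 (1 : K)
      simpa using this
    rw [h3] at h2
    exact absurd hdeg (not_lt.2 h2)
  obtain ⟨g, hgm, hgi, b', hb'⟩ := exists_monic_irreducible_factor b hbu
  have hgG : g ∈ facSet K n := (mem_facSet hn0 g).2 ⟨hgm, hgi, by rw [hb, hb']; exact ⟨d * b', by ring⟩⟩
  apply hα g hgG
  rw [mem_kerG g (b' * d) hgi.ne_zero (by rw [hb, hb']; ring), map_mul, Module.End.mul_apply, hdα, map_zero]

lemma normal_span {n : ℕ} (hn : n = Module.finrank K L) (α : L)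
    (hα : ∀ g ∈ facSet K n, α ∉ kerG K L n g) :
    Submodule.span K (Set.range fun i : Fin n => α ^ Fintype.card K ^ (i : ℕ)) = ⊤ :=
  (normal_lin hn α hα).span_eq_top_of_card_eq_finrank' (by simp [hn])

lemma exists_wit {n : ℕ} (hn : n = Module.finrank K L) (a : K[X]) (ha : a ∈ facSet K n) :
    ∃ w : L, w ∉ kerG K L n a ∧ ∀ g ∈ facSet K n, g ≠ a → w ∈ kerG K L n g := by
  have hn0 : 0 < n := hn ▸ Module.finrank_pos
  have hne := xn_ne K hn0
  obtain ⟨ham, hai, had⟩ := (mem_facSet hn0 a).1 ha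
  obtain ⟨k, b, hab, hkb⟩ := WfDvdMonoid.max_power_factor hne hai
  obtain ⟨c, hc⟩ := had
  have hnz : aeval (frobL K L) (c * b) ≠ 0 := by
    rw [Ne, minpoly_dvd_iff hn, hc]
    intro h
    have hc0 : c ≠ 0 := by rintro rfl; exact hne (by rw [hc, mul_zero])
    rw [mul_comm a c] at h
    exact hab ((mul_dvd_mul_iff_left hc0).1 h)
  obtain ⟨v, hv⟩ : ∃ v, aeval (frobL K L) (c * b) v ≠ 0 := by
    by_contra hcon
    push Not at hcon
    exact hnz (LinearMap.ext hcon)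
  refine ⟨aeval (frobL K L) b v, ?_, ?_⟩
  · rw [mem_kerG a c hai.ne_zero hc, ← Module.End.mul_apply, ← map_mul]
    exact hv
  · intro g hg hga
    obtain ⟨hgm, hgi, c', hc'⟩ := (mem_facSet hn0 g).1 hg
    rw [mem_kerG g c' hgi.ne_zero hc', ← Module.End.mul_apply, ← map_mul]
    have hgb : g ∣ b := by
      have : g ∣ a ^ k * b := by rw [← hkb, hc']; exact dvd_mul_right _ _
      rcases hgi.prime.dvd_or_dvd this with h | h
      · exfalso
        have := hgi.prime.dvd_of_dvd_pow h
        exact hga (eq_of_monic_of_associated hgm ham (hgi.associated_of_dvd hai this))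
      · exact h
    rw [(minpoly_dvd_iff hn _).2 (by rw [hc', mul_comm]; exact mul_dvd_mul_left _ hgb)]
    simp

open Classical in
lemma card_N {n : ℕ} (hn : n = Module.finrank K L) (S : Finset K[X]) (hS : S ⊆ facSet K n) :
    Fintype.card L ≤ 2 ^ S.card * (Finset.univ.filter fun x : L => ∀ g ∈ S, x ∉ kerG K L n g).card := by
  induction S using Finset.induction_on with
  | empty => simp
  | insert a S haS ih =>
    have h1 := ih ((Finset.subset_insert a S).trans hS)
    rw [Finset.card_insert_of_notMem haS, pow_succ, mul_assoc]
    refine h1.trans (Nat.mul_le_mul_left _ ?_)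
    obtain ⟨w, hw1, hw2⟩ := exists_wit hn a (hS (Finset.mem_insert_self a S))
    set A := Finset.univ.filter fun x : L => ∀ g ∈ S, x ∉ kerG K L n g with hA
    set B := Finset.univ.filter fun x : L => ∀ g ∈ insert a S, x ∉ kerG K L n g with hB
    have hB' : A.filter (fun x => x ∉ kerG K L n a) = B := by
      ext x; simp [hA, hB]; tauto
    have h2 := Finset.card_filter_add_card_filter_not (s := A) (fun x => x ∈ kerG K L n a)
    rw [hB'] at h2
    have h3 : (A.filter (fun x => x ∈ kerG K L n a)).card ≤ B.card := by
      refine Finset.card_le_card_of_injOn (fun x => x + w) ?_ (fun x _ y _ h => add_right_cancel h)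
      intro x hx
      simp only [Finset.coe_filter, hA, Finset.mem_filter, Finset.mem_univ, true_and,
        Set.mem_ofPred_eq] at hx
      simp only [hB, Finset.coe_filter, Finset.mem_univ, true_and, Set.mem_ofPred_eq,
        Finset.mem_insert]
      rintro g (rfl | hg)
      · intro h
        exact hw1 ((AddSubgroup.add_mem_cancel_left _ hx.2).1 h)
      · intro h
        have hga : g ≠ a := by rintro rfl; exact haS hg
        exact hx.1 g hg ((AddSubgroup.add_mem_cancel_right _
          (hw2 g (hS (Finset.mem_insert_of_mem hg)) hga)).1 h)
    omega

lemma sum_deg {n : ℕ} (hn : 0 < n) : ∑ g ∈ facSet K n, g.natDegree ≤ n := by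
  rw [← natDegree_prod_of_monic _ _ (fun g hg => ((mem_facSet hn g).1 hg).1)]
  have h1 : (∏ g ∈ facSet K n, g) ∣ X ^ n - 1 := by
    refine Finset.prod_dvd_of_coprime ?_ (fun g hg => ((mem_facSet hn g).1 hg).2.2)
    intro a ha b hb hab
    have ha' := (mem_facSet hn a).1 ha
    have hb' := (mem_facSet hn b).1 hb
    refine (ha'.2.1.coprime_iff_not_dvd).2 fun h => hab ?_
    exact eq_of_monic_of_associated ha'.1 hb'.1 (ha'.2.1.associated_of_dvd hb'.2.1 h)
  have h2 := natDegree_le_of_dvd h1 (xn_ne K hn)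
  have h3 : (X ^ n - 1 : K[X]).natDegree = n := by
    have := natDegree_X_pow_sub_C (n := n) (r := (1 : K))
    simpa using this
  rwa [h3] at h2

lemma card_small (D : ℕ) (S : Finset K[X]) (hS : ∀ g ∈ S, g.natDegree < D) :
    S.card ≤ Fintype.card K ^ D := by
  classical
  have h : S.card ≤ (Finset.univ : Finset (Fin D → K)).card := by
    refine Finset.card_le_card_of_injOn (fun g i => g.coeff i) (fun _ _ => by simp) ?_
    intro a ha b hb hab
    ext i
    by_cases hi : i < D
    · exact congrFun hab ⟨i, hi⟩
    · rw [coeff_eq_zero_of_natDegree_lt (by have := hS a ha; omega),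
        coeff_eq_zero_of_natDegree_lt (by have := hS b hb; omega)]
  simpa using h

lemma fac_bound (N : ℕ) : ∃ Q0 : ℕ, ∀ (K : Type) [Field K] [Fintype K] (n : ℕ), 0 < n →
    Q0 ≤ Fintype.card K ^ n → (2 ^ (facSet K n).card) ^ N ≤ Fintype.card K ^ n := by
  refine ⟨2 ^ (2 * 2 ^ (N * (2 * N)) * N), fun K _ _ n hn hQ => ?_⟩
  have hone : ∀ g ∈ facSet K n, 1 ≤ g.natDegree := fun g hg =>
    ((mem_facSet hn g).1 hg).2.1.natDegree_pos
  by_cases hq : 2 ^ N ≤ Fintype.card K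
  · have h1 : (facSet K n).card ≤ n := by
      refine le_trans ?_ (sum_deg (K := K) hn)
      rw [Finset.card_eq_sum_ones]
      exact Finset.sum_le_sum hone
    calc (2 ^ (facSet K n).card) ^ N ≤ (2 ^ n) ^ N := by gcongr; norm_num
      _ = (2 ^ N) ^ n := by rw [← pow_mul, ← pow_mul, mul_comm]
      _ ≤ _ := by gcongr
  · push Not at hq
    classical
    set S1 := (facSet K n).filter (fun g => g.natDegree < 2 * N)
    set S2 := (facSet K n).filter (fun g => ¬ g.natDegree < 2 * N)
    have h12 : S1.card + S2.card = (facSet K n).card :=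
      Finset.card_filter_add_card_filter_not _
    have h1 : S1.card ≤ 2 ^ (N * (2 * N)) := by
      refine (card_small (2 * N) S1 (fun g hg => (Finset.mem_filter.1 hg).2)).trans ?_
      rw [pow_mul 2 N]
      exact Nat.pow_le_pow_left hq.le _
    have h2 : S2.card * (2 * N) ≤ n := by
      refine le_trans ?_ (sum_deg (K := K) hn)
      refine le_trans ?_ (Finset.sum_le_sum_of_subset (Finset.filter_subset _ _) : ∑ g ∈ S2, g.natDegree ≤ _)
      rw [← smul_eq_mul]
      refine Finset.card_nsmul_le_sum _ _ _ fun g hg => ?_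
      have := (Finset.mem_filter.1 hg).2
      omega
    have hq2 : 2 ≤ Fintype.card K := Fintype.one_lt_card
    refine (pow_le_pow_iff_left₀ (Nat.zero_le _) (Nat.zero_le _) two_ne_zero).1 ?_
    rw [← h12]
    calc ((2 ^ (S1.card + S2.card)) ^ N) ^ 2 = 2 ^ (2 * S1.card * N) * 2 ^ (S2.card * (2 * N)) := by
          rw [← pow_mul, ← pow_mul, ← pow_add]; congr 1; ring
      _ ≤ 2 ^ (2 * 2 ^ (N * (2 * N)) * N) * 2 ^ n := by gcongr <;> norm_num
      _ ≤ Fintype.card K ^ n * Fintype.card K ^ n := by gcongr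
      _ = _ := by ring

end NormalElems


section Params

lemma one_factor {W Q : ℝ} (hW : 100 ≤ W) (hQ : W ^ 400 ≤ Q) (i j : ℕ) (hij : i + j ≤ 400) :
    W ^ i ≤ Q / W ^ j := by
  have hW0 : 0 < W := by linarith
  rw [le_div_iff₀ (by positivity), ← pow_add]
  exact (pow_le_pow_right₀ (by linarith) hij).trans hQ

lemma num_T1 (W Q d D : ℝ) (hW : 100 ≤ W) (hQ : W ^ 400 ≤ Q) (hd0 : 0 ≤ d) (hd : d ≤ W ^ 9)
    (hD0 : 0 ≤ D) (hD : D ≤ W ^ 10) :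
    Q + √(Q * (Q ^ 2 * (Q * (2 * d * D + 2) / W ^ 150 + 2 * d * D) + 3 * D * Q * Q)) ≤
      (Q / W ^ 30) ^ 2 := by
  have hW0 : 0 < W := by linarith
  have hQ0 : 0 < Q := lt_of_lt_of_le (by positivity) hQ
  have hdD : d * D ≤ W ^ 19 := by
    calc d * D ≤ W ^ 9 * W ^ 10 := by gcongr
      _ = W ^ 19 := by ring
  have h1 : (1 : ℝ) ≤ W ^ 19 := one_le_pow₀ (by linarith)
  have h20 : W ^ 20 = W ^ 19 * W := by ring
  have h19 : W ^ 10 ≤ W ^ 19 := pow_le_pow_right₀ (by linarith) (by norm_num)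
  have hA : 2 * d * D + 2 ≤ W ^ 20 := by nlinarith
  have hA' : 2 * d * D + 3 * D ≤ W ^ 20 := by nlinarith
  have hB : Q * (2 * d * D + 2) / W ^ 150 ≤ Q / W ^ 130 := by
    rw [div_le_div_iff₀ (by positivity) (by positivity)]
    calc Q * (2 * d * D + 2) * W ^ 130 ≤ Q * W ^ 20 * W ^ 130 := by gcongr
      _ = Q * W ^ 150 := by ring
  have hB' : 2 * d * D + 3 * D ≤ Q / W ^ 130 :=
    hA'.trans (one_factor hW hQ 20 130 (by norm_num))
  have hC : 2 * (Q / W ^ 130) ≤ Q / W ^ 124 := by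
    rw [mul_div_assoc', div_le_div_iff₀ (by positivity) (by positivity)]
    have : (2 : ℝ) ≤ W ^ 6 := by
      calc (2 : ℝ) ≤ W := by linarith
        _ ≤ W ^ 6 := le_self_pow₀ (by linarith) (by norm_num)
    calc 2 * Q * W ^ 124 ≤ W ^ 6 * Q * W ^ 124 := by gcongr
      _ = Q * W ^ 130 := by ring
  have hin : Q * (Q ^ 2 * (Q * (2 * d * D + 2) / W ^ 150 + 2 * d * D) + 3 * D * Q * Q) ≤
      (Q ^ 2 / W ^ 62) ^ 2 := by
    calc _ = Q ^ 3 * (Q * (2 * d * D + 2) / W ^ 150 + (2 * d * D + 3 * D)) := by ring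
      _ ≤ Q ^ 3 * (Q / W ^ 124) := by
          refine mul_le_mul_of_nonneg_left ?_ (by positivity)
          linarith
      _ = (Q ^ 2 / W ^ 62) ^ 2 := by
          rw [div_pow, ← pow_mul, ← pow_mul]; ring
  have hs : √(Q * (Q ^ 2 * (Q * (2 * d * D + 2) / W ^ 150 + 2 * d * D) + 3 * D * Q * Q)) ≤
      Q ^ 2 / W ^ 62 := Real.sqrt_le_iff.2 ⟨by positivity, hin⟩
  have h3 : Q ≤ Q ^ 2 / W ^ 62 := by
    have := one_factor hW hQ 0 62 (by norm_num)
    calc Q = Q * W ^ 0 := by simp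
      _ ≤ Q * (Q / W ^ 62) := by gcongr
      _ = _ := by ring
  have h4 : 2 * (Q ^ 2 / W ^ 62) ≤ (Q / W ^ 30) ^ 2 := by
    rw [div_pow, ← pow_mul, mul_div_assoc', div_le_div_iff₀ (by positivity) (by positivity)]
    have : (2 : ℝ) ≤ W ^ 2 := by nlinarith
    calc 2 * Q ^ 2 * W ^ (30 * 2) ≤ W ^ 2 * Q ^ 2 * W ^ (30 * 2) := by gcongr
      _ = Q ^ 2 * W ^ 62 := by ring
  linarith

lemma num_T2 (W Q D : ℝ) (hW : 100 ≤ W) (hQ : W ^ 400 ≤ Q)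
    (hD : D ≤ W ^ 10) : √(2 * Q) + D ≤ Q / W ^ 30 := by
  have hW0 : 0 < W := by linarith
  have hQ0 : 0 < Q := lt_of_lt_of_le (by positivity) hQ
  have h1 : √(2 * Q) ≤ Q / W ^ 31 := by
    refine Real.sqrt_le_iff.2 ⟨by positivity, ?_⟩
    have h2 := one_factor hW hQ 1 62 (by norm_num)
    calc 2 * Q ≤ W ^ 1 * Q := by gcongr; linarith
      _ ≤ (Q / W ^ 62) * Q := by gcongr
      _ = _ := by rw [div_pow, ← pow_mul]; ring
  have h2 : D ≤ Q / W ^ 31 := hD.trans (one_factor hW hQ 10 31 (by norm_num))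
  have h3 : 2 * (Q / W ^ 31) ≤ Q / W ^ 30 := by
    rw [mul_div_assoc', div_le_div_iff₀ (by positivity) (by positivity)]
    calc 2 * Q * W ^ 30 ≤ W * Q * W ^ 30 := by gcongr; linarith
      _ = Q * W ^ 31 := by ring
  linarith

lemma num_big (W Q d D G2 Nc P e mm Y R : ℝ) (hW : 100 ≤ W) (hQ : W ^ 400 ≤ Q)
    (hd0 : 0 ≤ d) (hd : d ≤ W ^ 9)
    (hD : D + 1 ≤ W ^ 11) (hD0 : 0 ≤ D)
    (hG0 : 0 ≤ G2) (hG : G2 ≤ W) (hNc0 : 0 ≤ Nc) (hNc : Q ≤ G2 * Nc) (hP0 : 0 ≤ P)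
    (hP : 4 * P ≤ W) (he0 : 1 ≤ e) (he : e ≤ W) (hm0 : 0 ≤ mm) (hm : mm + 1 ≤ W) (hY : Y = W ^ 8)
    (hR : R = G2 * (d ^ 2 * (Q / W ^ 30) + (D + 1))) :
    (2 * P + 1) * R + P * ((mm + 1) * Q / Y) < Nc * (1 / e) ^ 2 / 2 := by
  have hW0 : 0 < W := by linarith
  have hQ0 : 0 < Q := lt_of_lt_of_le (by positivity) hQ
  have h1 : d ^ 2 * (Q / W ^ 30) ≤ Q / W ^ 12 := by
    calc d ^ 2 * (Q / W ^ 30) ≤ (W ^ 9) ^ 2 * (Q / W ^ 30) := by gcongr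
      _ = Q / W ^ 12 := by field_simp
  have h2 : D + 1 ≤ Q / W ^ 12 := hD.trans (one_factor hW hQ 11 12 (by norm_num))
  have h3 : R ≤ W * (2 * (Q / W ^ 12)) := by
    rw [hR]
    have : d ^ 2 * (Q / W ^ 30) + (D + 1) ≤ 2 * (Q / W ^ 12) := by linarith
    gcongr
  have h4 : (2 * P + 1) * R ≤ W * (W * (2 * (Q / W ^ 12))) := by
    have : 0 ≤ R := by rw [hR]; positivity
    gcongr
    linarith
  have h5 : P * ((mm + 1) * Q / Y) ≤ W * (W * Q / W ^ 8) := by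
    rw [hY]
    gcongr
    linarith
  have h6 : Q / W ≤ Nc := by
    rw [div_le_iff₀ hW0]
    calc Q ≤ G2 * Nc := hNc
      _ ≤ W * Nc := by gcongr
      _ = _ := by ring
  have h7 : (Q / W) * (1 / W) ^ 2 / 2 ≤ Nc * (1 / e) ^ 2 / 2 := by
    gcongr
  have h8 : W * (W * (2 * (Q / W ^ 12))) + W * (W * Q / W ^ 8) < (Q / W) * (1 / W) ^ 2 / 2 := by
    have e1 : W * (W * (2 * (Q / W ^ 12))) = (Q / W ^ 10) * 2 := by field_simp
    have e2 : W * (W * Q / W ^ 8) = (Q / W ^ 10) * W ^ 4 := by field_simp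
    have e3 : (Q / W) * (1 / W) ^ 2 / 2 = (Q / W ^ 10) * (W ^ 7 / 2) := by field_simp
    rw [e1, e2, e3, ← mul_add]
    refine mul_lt_mul_of_pos_left ?_ (by positivity)
    have hx : W ^ 7 = W ^ 4 * W ^ 3 := by ring
    have h3' : (100 : ℝ) ≤ W ^ 3 := hW.trans (le_self_pow₀ (by linarith) (by norm_num))
    have h4' : (1 : ℝ) ≤ W ^ 4 := one_le_pow₀ (by linarith)
    nlinarith
  linarith

lemma sieve_params (N : ℕ) (hN : 0 < N) : ∃ W0 : ℕ, ∀ w, W0 ≤ w → ∀ M : ℕ, 0 < M →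
    M < (w + 1) ^ N → ∃ (e : ℕ) (Pb : Finset ℕ), e ∣ M ∧ e ≤ w ∧ 0 < e ∧
      (∀ ℓ, ℓ ∈ Pb ↔ ℓ.Prime ∧ ℓ ∣ M ∧ ¬ ℓ ∣ e) ∧ (∑ ℓ ∈ Pb, (1 / (ℓ : ℝ)) ≤ 1 / 4) ∧
      4 * Pb.card ≤ w := by
  refine ⟨4 ^ (4 ^ (4 * N)), fun w hw M hM hMw => ?_⟩
  have hw0 : w ≠ 0 := by
    have : 0 < 4 ^ (4 ^ (4 * N)) := by positivity
    omega
  set z := Nat.log 4 w with hz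
  have hz1 : 4 ^ z ≤ w := Nat.pow_log_le_self 4 hw0
  have hz2 : w < 4 ^ (z + 1) := Nat.lt_pow_succ_log_self (by norm_num) w
  have hz3 : 4 ^ (4 * N) ≤ z := Nat.le_log_of_pow_le (by norm_num) hw
  have hz4 : z < 4 ^ z := Nat.lt_pow_self (by norm_num)
  set S := M.primeFactors.filter (fun ℓ => ℓ ≤ z) with hS
  set Pb := M.primeFactors.filter (fun ℓ => ¬ ℓ ≤ z) with hPb
  set e := ∏ ℓ ∈ S, ℓ with he
  have hSp : ∀ ℓ ∈ S, ℓ.Prime := fun ℓ h => Nat.prime_of_mem_primeFactors (Finset.mem_filter.1 h).1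
  have heM : e ∣ M := Finset.prod_primes_dvd M (fun ℓ h => (hSp ℓ h).prime)
    (fun ℓ h => Nat.dvd_of_mem_primeFactors (Finset.mem_filter.1 h).1)
  have he0 : 0 < e := Nat.pos_of_dvd_of_pos heM hM
  have hePr : e ∣ primorial z := by
    refine Finset.prod_primes_dvd _ (fun ℓ h => (hSp ℓ h).prime) fun ℓ h => ?_
    rw [primorial]
    refine Finset.dvd_prod_of_mem _ ?_
    simp only [Finset.mem_filter, Finset.mem_range]
    exact ⟨Nat.lt_succ_of_le (Finset.mem_filter.1 h).2, hSp ℓ h⟩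
  have hew : e ≤ w := ((Nat.le_of_dvd (primorial_pos z) hePr).trans (primorial_le_four_pow z)).trans hz1
  have hcard : 4 * Pb.card ≤ z + 1 := by
    have h1 : (∏ ℓ ∈ Pb, ℓ) ∣ M := Finset.prod_primes_dvd M
      (fun ℓ h => (Nat.prime_of_mem_primeFactors (Finset.mem_filter.1 h).1).prime)
      (fun ℓ h => Nat.dvd_of_mem_primeFactors (Finset.mem_filter.1 h).1)
    have h2 : (4 ^ (4 * N)) ^ Pb.card ≤ ∏ ℓ ∈ Pb, ℓ := by
      refine Finset.pow_card_le_prod _ _ _ fun ℓ h => ?_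
      have := (Finset.mem_filter.1 h).2
      omega
    have h3 := Nat.le_of_dvd hM h1
    have h4 : (w + 1) ^ N ≤ (4 ^ (z + 1)) ^ N := Nat.pow_le_pow_left hz2 N
    have h5 : (4 ^ (4 * N)) ^ Pb.card < (4 ^ (z + 1)) ^ N := by omega
    rw [← pow_mul, ← pow_mul] at h5
    have h6 := (Nat.pow_lt_pow_iff_right (by norm_num : 1 < 4)).1 h5
    have h7 : N * (4 * Pb.card) < N * (z + 1) := by
      calc _ = 4 * N * Pb.card := by ring
        _ < (z + 1) * N := h6
        _ = _ := by ring
    exact (Nat.lt_of_mul_lt_mul_left h7).le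
  refine ⟨e, Pb, heM, hew, he0, ?_, ?_, by omega⟩
  · intro ℓ
    rw [hPb, Finset.mem_filter, Nat.mem_primeFactors]
    constructor
    · rintro ⟨⟨h1, h2, h3⟩, h4⟩
      refine ⟨h1, h2, fun h5 => h4 ?_⟩
      obtain ⟨p, hp, hlp⟩ := (h1.prime.dvd_finsetProd_iff _).1 h5
      have := (Nat.prime_dvd_prime_iff_eq h1 (hSp p hp)).1 hlp
      rw [this]
      exact (Finset.mem_filter.1 hp).2
    · rintro ⟨h1, h2, h3⟩
      refine ⟨⟨h1, h2, hM.ne'⟩, fun h4 => h3 ?_⟩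
      exact Finset.dvd_prod_of_mem _
        (Finset.mem_filter.2 ⟨Nat.mem_primeFactors.2 ⟨h1, h2, hM.ne'⟩, h4⟩)
  · have hz0 : (0 : ℝ) < (z : ℝ) + 1 := by positivity
    calc ∑ ℓ ∈ Pb, (1 / (ℓ : ℝ)) ≤ ∑ ℓ ∈ Pb, (1 / ((z : ℝ) + 1)) := by
          refine Finset.sum_le_sum fun ℓ h => ?_
          have h1 := (Finset.mem_filter.1 h).2
          have h2 : z + 1 ≤ ℓ := by omega
          have h3 : (z : ℝ) + 1 ≤ ℓ := by exact_mod_cast h2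
          exact one_div_le_one_div_of_le hz0 h3
      _ = Pb.card / ((z : ℝ) + 1) := by rw [Finset.sum_const, nsmul_eq_mul]; ring
      _ ≤ 1 / 4 := by
          rw [div_le_div_iff₀ hz0 (by norm_num)]
          have : ((4 * Pb.card : ℕ) : ℝ) ≤ ((z + 1 : ℕ) : ℝ) := by exact_mod_cast hcard
          push_cast at this
          linarith

lemma nat_root (N : ℕ) (hN : 0 < N) (Q : ℕ) : ∃ w : ℕ, w ^ N ≤ Q ∧ Q < (w + 1) ^ N := by
  have hex : ∃ w, Q < (w + 1) ^ N := ⟨Q, (Nat.lt_succ_self Q).trans_le (Nat.le_self_pow hN.ne' _)⟩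
  classical
  refine ⟨Nat.find hex, ?_, Nat.find_spec hex⟩
  rcases Nat.eq_zero_or_pos (Nat.find hex) with h | h
  · rw [h, zero_pow hN.ne']; omega
  · have h1 := Nat.find_min hex (m := Nat.find hex - 1) (by omega)
    rw [Nat.sub_add_cancel h] at h1
    omega

end Params


section Core

lemma hE_bound (w d m E Q : ℕ) (hw : 2 * m + 100 ≤ w) (hd : d ≤ w ^ 9) (hQ : w ^ 400 ≤ Q)
    (hQE : Q = d * E + 1) : (4 + d * (2 * d * (2 * d * m))) * (w ^ 150) ^ 2 + 1 ≤ E := by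
  have h1 : (4 + d * (2 * d * (2 * d * m))) * (w ^ 150) ^ 2 + 1 ≤ w ^ 330 := by
    have ha : d * (2 * d * (2 * d * m)) ≤ 2 * w ^ 28 := by
      calc d * (2 * d * (2 * d * m)) ≤ w ^ 9 * (2 * w ^ 9 * (w ^ 9 * (2 * m))) := by
            have : 2 * d * m = d * (2 * m) := by ring
            rw [this]
            gcongr
        _ ≤ w ^ 9 * (2 * w ^ 9 * (w ^ 9 * w)) := by gcongr; omega
        _ = 2 * w ^ 28 := by ring
    have hb : 1 ≤ w ^ 28 := Nat.one_le_pow _ _ (by omega)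
    have hc : 4 + d * (2 * d * (2 * d * m)) + 1 ≤ w ^ 29 := by
      have : w ^ 29 = w ^ 28 * w := by ring
      nlinarith
    have hdd : 1 ≤ (w ^ 150) ^ 2 := Nat.one_le_pow _ _ (Nat.pow_pos (by omega))
    calc (4 + d * (2 * d * (2 * d * m))) * (w ^ 150) ^ 2 + 1
        ≤ (4 + d * (2 * d * (2 * d * m)) + 1) * (w ^ 150) ^ 2 := by nlinarith
      _ ≤ w ^ 29 * (w ^ 150) ^ 2 := by gcongr
      _ = w ^ 29 * w ^ 300 := by rw [← pow_mul]
      _ ≤ w ^ 330 := by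
        rw [← pow_add]; exact Nat.pow_le_pow_right (by omega) (by norm_num)
  by_contra hcon
  have h2 : E ≤ w ^ 330 := by omega
  have h3 : Q ≤ w ^ 339 + 1 := by
    rw [hQE]
    have : d * E ≤ w ^ 9 * w ^ 330 := Nat.mul_le_mul hd h2
    have h9 : w ^ 9 * w ^ 330 = w ^ 339 := by ring
    omega
  have h4 : w ^ 339 + 1 < w ^ 400 := by
    have h5 : w ^ 340 ≤ w ^ 400 := Nat.pow_le_pow_right (by omega) (by norm_num)
    have h6 : w ^ 340 = w ^ 339 * w := by ring
    have h7 : 1 ≤ w ^ 339 := Nat.one_le_pow _ _ (by omega)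
    nlinarith
  omega

lemma core (m : ℕ) : ∃ Q0 : ℕ, ∀ (K L : Type) [Field K] [Field L] [Fintype K] [Fintype L]
    [Algebra K L] (n : ℕ), Fintype.card L = Fintype.card K ^ n → n = Module.finrank K L →
    Q0 ≤ Fintype.card L → ∀ (f₁ f₂ : L[X]) (k : ℕ), f₁.natDegree ≤ m → f₂.natDegree ≤ m →
    0 < k → k.Coprime (Fintype.card L - 1) → (RootData f₁ f₂ k ∨ RootData f₂ f₁ k) →
    ∃ x : L, (∀ g ∈ facSet K n, x ∉ kerG K L n g) ∧ orderOf x = Fintype.card L - 1 ∧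
      orderOf (f₁.eval x / f₂.eval x) = Fintype.card L - 1 := by
  obtain ⟨N, hN⟩ : ∃ N : ℕ, N = 400 := ⟨_, rfl⟩
  have hNpos : 0 < N := by omega
  obtain ⟨W0, hW0⟩ := sieve_params N hNpos
  obtain ⟨Q1, hQ1⟩ := fac_bound N
  refine ⟨Q1 + (W0 + (2 * m + 100)) ^ N, ?_⟩
  intro K L _ _ _ _ _ n hcard hn hQ f₁ f₂ k hf₁ hf₂ hk hkc hroot
  classical
  have hn0 : 0 < n := hn ▸ Module.finrank_pos
  obtain ⟨w, hw1, hw2⟩ := nat_root N hNpos (Fintype.card L)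
  have hww : W0 + (2 * m + 100) ≤ w := by
    have h1 : (W0 + (2 * m + 100)) ^ N < (w + 1) ^ N := by
      refine lt_of_le_of_lt ?_ hw2
      exact (Nat.le_add_left _ _).trans hQ
    have := lt_of_pow_lt_pow_left₀ N (Nat.zero_le _) h1
    exact Nat.lt_succ_iff.1 this
  have hL1 := Fintype.one_lt_card (α := L)
  obtain ⟨e, Pb, heM, hew, he0, hPb, hsum, hPc⟩ := hW0 w (by omega) (Fintype.card L - 1)
    (by omega) (lt_of_le_of_lt (Nat.sub_le _ _) hw2)
  have hG : 2 ^ (facSet K n).card ≤ w := by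
    have h1 := hQ1 K n hn0 (by rw [← hcard]; exact (Nat.le_add_right _ _).trans hQ)
    rw [← hcard] at h1
    have := lt_of_pow_lt_pow_left₀ N (Nat.zero_le _) (h1.trans_lt hw2)
    exact Nat.lt_succ_iff.1 this
  set Nf := Finset.univ.filter fun x : L => ∀ g ∈ facSet K n, x ∉ kerG K L n g with hNf
  have hNc : Fintype.card L ≤ 2 ^ (facSet K n).card * Nf.card := card_N hn _ (Finset.Subset.refl _)
  have hWr : (100 : ℝ) ≤ w := by
    have : 100 ≤ w := by omega
    exact_mod_cast this
  have hQr : (w : ℝ) ^ N ≤ Fintype.card L := by exact_mod_cast hw1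
  have hmr : 2 * (m : ℝ) + 100 ≤ w := by
    have : 2 * m + 100 ≤ w := by omega
    exact_mod_cast this
  have hm0 : (0 : ℝ) ≤ m := Nat.cast_nonneg m
  have hw0 : (0 : ℝ) < w := by linarith
  set R : ℝ := 2 ^ (facSet K n).card *
    (((w : ℝ) ^ 9) ^ 2 * ((Fintype.card L : ℝ) / (w : ℝ) ^ 30) + (2 * (w : ℝ) ^ 9 * m + 1)) with hR
  obtain ⟨x, hx, hx1, hx2⟩ := sieve Nf f₁ f₂ m k e hf₁ hf₂ hk hroot heM Pb hPb hsum R (w ^ 8)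
    (Nat.pow_pos (by omega)) (by
      intro d E hdE hd
      have hdw : d ≤ w ^ 9 := by
        rcases hd with rfl | ⟨ℓ, _, hℓ, rfl⟩
        · exact hew.trans (Nat.le_self_pow (by norm_num) _)
        · calc e * ℓ ≤ w * w ^ 8 := Nat.mul_le_mul hew hℓ
            _ = w ^ 9 := by ring
      have hdr : (d : ℝ) ≤ (w : ℝ) ^ 9 := by exact_mod_cast hdw
      have hd0 : (0 : ℝ) ≤ d := Nat.cast_nonneg d
      have hdD : ((2 * d * m : ℕ) : ℝ) ≤ (w : ℝ) ^ 10 := by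
        push_cast
        calc 2 * (d : ℝ) * m = d * (2 * m) := by ring
          _ ≤ (w : ℝ) ^ 9 * w := by gcongr; linarith
          _ = _ := by ring
      intro A B hA0 hB0 hA hB
      refine (count_A d E m (w ^ 150) k hdE f₁ f₂ hf₁ hf₂ ?_ hroot
        (Nat.one_le_pow _ _ (by omega))
        (hE_bound w d m E _ (by omega) hdw (hN ▸ hw1) hdE) ((Fintype.card L : ℝ) / (w : ℝ) ^ 30)
        (by positivity) ?_ ?_ A B hA0 hB0 hA hB (kerG K L n) (facSet K n) Nf
        (by intro x; simp [hNf])).trans ?_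
      · exact hkc.coprime_dvd_right ⟨E, by omega⟩
      · have := num_T1 w (Fintype.card L) d (2 * d * m : ℕ) hWr (hN ▸ hQr) hd0 hdr (Nat.cast_nonneg _) hdD
        rw [Nat.cast_pow]
        exact this
      · exact num_T2 w (Fintype.card L) _ hWr (hN ▸ hQr) hdD
      · rw [hR]
        gcongr)
    (by
      rw [Nat.cast_pow]
      refine num_big w (Fintype.card L) (w ^ 9) (2 * (w : ℝ) ^ 9 * m) (2 ^ (facSet K n).card)
        Nf.card Pb.card e m _ R hWr (hN ▸ hQr) (by positivity) le_rfl ?_ (by positivity) (by positivity)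
        (by exact_mod_cast hG) (Nat.cast_nonneg _) (by exact_mod_cast hNc) (Nat.cast_nonneg _)
        (by exact_mod_cast hPc) (by exact_mod_cast he0) (by exact_mod_cast hew) hm0 (by linarith)
        rfl hR
      have h1 : (1 : ℝ) ≤ (w : ℝ) ^ 10 := one_le_pow₀ (by linarith)
      calc 2 * (w : ℝ) ^ 9 * m + 1 = (w : ℝ) ^ 9 * (2 * m) + 1 := by ring
        _ ≤ (w : ℝ) ^ 9 * w + (w : ℝ) ^ 10 := by gcongr; linarith
        _ = (w : ℝ) ^ 10 * 2 := by ring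
        _ ≤ (w : ℝ) ^ 10 * w := by gcongr; linarith
        _ = _ := by ring)
  exact ⟨x, by simpa [hNf] using hx, hx1, hx2⟩

lemma ratEval_aux {F : Type} [Field F] (f₁ f₂ : F[X]) (h2 : f₂ ≠ 0) (hc : IsCoprime f₁ f₂) (x : F) :
    (algebraMap F[X] (RatFunc F) f₁ / algebraMap F[X] (RatFunc F) f₂).eval (RingHom.id F) x =
      f₁.eval x / f₂.eval x := by
  set f := algebraMap F[X] (RatFunc F) f₁ / algebraMap F[X] (RatFunc F) f₂ with hf
  have h1 : f.num * f₂ = f₁ * f.denom := (RatFunc.num_mul_eq_mul_denom_iff h2).2 hf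
  have h3 : IsCoprime f.num f.denom := RatFunc.isCoprime_num_denom f
  have h1x : f.num.eval x * f₂.eval x = f₁.eval x * f.denom.eval x := by
    rw [← eval_mul, h1, eval_mul]
  have key : ∀ a b : F[X], IsCoprime a b → b.eval x = 0 → a.eval x ≠ 0 := by
    rintro a b ⟨u, v, huv⟩ hb ha
    have := congrArg (Polynomial.eval x) huv
    simp [ha, hb] at this
  rw [RatFunc.eval]
  simp only [eval₂_id]
  by_cases hz : f₂.eval x = 0
  · rw [hz, mul_zero] at h1x
    have := key _ _ hc hz
    have h4 : f.denom.eval x = 0 := by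
      rcases mul_eq_zero.1 h1x.symm with h | h
      · exact absurd h this
      · exact h
    rw [hz, h4]; simp
  · have h4 : f.denom.eval x ≠ 0 := by
      intro h4
      rw [h4, mul_zero] at h1x
      rcases mul_eq_zero.1 h1x with h | h
      · exact key _ _ h3 h4 h
      · exact hz h
    rw [div_eq_div_iff h4 hz, h1x]

lemma finite_aux (Q0 : ℕ) (S : Set (ℕ × ℕ)) (hS : ∀ x ∈ S, 2 ≤ x.1 ∧ 0 < x.2 ∧ x.1 ^ x.2 < Q0) :
    S.Finite := by
  refine Set.Finite.subset ((Set.finite_Iio Q0).prod (Set.finite_Iio Q0)) ?_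
  rintro ⟨q, n⟩ hx
  obtain ⟨h1, h2, h3⟩ := hS _ hx
  simp only at h1 h2 h3
  refine ⟨?_, ?_⟩
  · exact lt_of_le_of_lt (Nat.le_self_pow h2.ne' q) h3
  · exact lt_of_lt_of_le (Nat.lt_pow_self (by omega)) h3.le

end Core

theorem stmt5 (m₁ m₂ : ℕ) (hm₁ : 0 < m₁) (hm₂ : 0 < m₂) :
    {x : ℕ × ℕ | IsPrimePow x.1 ∧ 0 < x.2 ∧ ¬ memB m₁ m₂ x.1 x.2}.Finite := by
  obtain ⟨Q0, hQ0⟩ := core (max m₁ m₂)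
  refine finite_aux Q0 _ ?_
  rintro ⟨q, n⟩ ⟨hq, hn, hB⟩
  refine ⟨hq.two_le, hn, ?_⟩
  by_contra hlt
  apply hB
  intro K L _ _ _ _ _ hK hL f hf
  obtain ⟨f₁, f₂, h2, hfe, hd1, hd2, hcop, k, g, hk, hgm, hgi, hgX, hkc, hg1, hg2⟩ := hf
  have hfin : n = Module.finrank K L := by
    have h1 := Module.card_eq_pow_finrank (K := K) (V := L)
    rw [hL, hK] at h1
    exact Nat.pow_right_injective hq.two_le h1
  obtain ⟨x, hx0, hx1, hx2⟩ := hQ0 K L n (by rw [hL, hK]) hfin (by rw [hL]; exact not_lt.1 hlt)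
    f₁ f₂ k (hd1.trans (le_max_left _ _)) (hd2.trans (le_max_right _ _)) hk hkc
    (root_data f₁ f₂ g hcop k hk hgm hgi hgX hg1 hg2)
  refine ⟨x, hx1, ⟨normal_lin hfin x hx0, normal_span hfin x hx0⟩, ?_⟩
  rw [IsPrimitiveElem, ratEval, hfe, ratEval_aux f₁ f₂ h2 hcop]
  exact hx2
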